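/- arXiv:math/0106231 — 3 statements merged into one kernel-verified Lean document; each statement's English description precedes it below -/
import Mathlib

section
/- Let N > p > 1, γ ≥ 0, and p − 1 < q < ((N+γ)(p−1) + p + γ)/(N−p). Suppose u : ℝ^N → ℝ is a nonnegative C¹ radial function (i.e. u(x) = V(|x|) for some V : [0,∞) → ℝ) satisfying ∫_{ℝ^N} |∇u(x)|^{p−2}⟨∇u(x), ∇φ(x)⟩ dx = ∫_{ℝ^N} |x|^γ u(x)^q φ(x) dx for every C^∞ compactly supported φ : ℝ^N → ℝ. Then u ≡ 0. -/
section Helpers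
open MeasureTheory Metric Set Filter Topology

lemma ode_basic (N p γ q : ℝ) (hp : 1 < p) (hpN : p < N) (hγ : 0 ≤ γ) (hq₁ : p - 1 < q)
    (v v' : ℝ → ℝ) (hv : ∀ r, HasDerivAt v (v' r) r) (hpos : ∀ r, 0 ≤ v r)
    (F : ℝ → ℝ) (hF : ∀ r, F r = ∫ s in (0:ℝ)..r, s ^ (N - 1 + γ) * v s ^ q)
    (hode : ∀ r, 0 < r → r ^ (N - 1) * (|v' r| ^ (p - 2) * v' r) = - F r) :
    (∀ r, HasDerivAt F (r ^ (N - 1 + γ) * v r ^ q) r) ∧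
    (MonotoneOn F (Ici 0)) ∧ (∀ r, 0 < r → v' r ≤ 0 ∧ r ^ (N - 1) * |v' r| ^ (p - 1) = F r) ∧
    AntitoneOn v (Ici 0) ∧ (∀ R, 0 < R → v R ^ q * (R ^ (N + γ) / (N + γ)) ≤ F R) := by
  have hvc : Continuous v := continuous_iff_continuousAt.2 fun r => (hv r).continuousAt
  have hfc : Continuous fun s : ℝ => s ^ (N - 1 + γ) * v s ^ q :=
    (continuous_id.rpow_const fun x => Or.inr (by linarith)).mul
      (hvc.rpow_const fun x => Or.inr (by linarith))
  have hFd : ∀ r, HasDerivAt F (r ^ (N - 1 + γ) * v r ^ q) r := by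
    intro r
    have : F = fun r => ∫ s in (0:ℝ)..r, s ^ (N - 1 + γ) * v s ^ q := funext hF
    rw [this]
    exact hfc.integral_hasStrictDerivAt 0 r |>.hasDerivAt
  have hFm : MonotoneOn F (Ici 0) := by
    apply monotoneOn_of_hasDerivWithinAt_nonneg (convex_Ici 0)
      (fun x _ => (hFd x).continuousAt.continuousWithinAt)
      (fun x _ => (hFd x).hasDerivWithinAt)
    intro x hx
    rw [interior_Ici] at hx
    exact mul_nonneg (Real.rpow_nonneg (le_of_lt hx) _) (Real.rpow_nonneg (hpos x) _)
  have hF0 : F 0 = 0 := by rw [hF]; simp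
  have hFn : ∀ r, 0 ≤ r → 0 ≤ F r := fun r hr => hF0 ▸ hFm (mem_Ici.2 le_rfl) hr hr
  have hv' : ∀ r, 0 < r → v' r ≤ 0 ∧ r ^ (N - 1) * |v' r| ^ (p - 1) = F r := by
    intro r hr
    have h1 := hode r hr
    have h2 := hFn r hr.le
    have h3 : 0 < r ^ (N - 1) := Real.rpow_pos_of_pos hr _
    rcases lt_trichotomy (v' r) 0 with h | h | h
    · refine ⟨h.le, ?_⟩
      have h4 : 0 < |v' r| := abs_pos.2 h.ne
      have h5 : |v' r| ^ (p - 1) = |v' r| ^ (p - 2) * |v' r| := by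
        rw [← Real.rpow_add_one h4.ne']; congr 1; ring
      rw [h5, abs_of_neg h]
      rw [abs_of_neg h] at h1
      linarith
    · refine ⟨h.le, ?_⟩
      rw [h] at h1 ⊢
      simp only [mul_zero, abs_zero] at h1 ⊢
      rw [Real.zero_rpow (by linarith)]; linarith
    · exfalso
      have : 0 < r ^ (N - 1) * (|v' r| ^ (p - 2) * v' r) := by positivity
      linarith
  have hva : AntitoneOn v (Ici 0) := by
    apply antitoneOn_of_hasDerivWithinAt_nonpos (convex_Ici 0) hvc.continuousOn
      (fun x _ => (hv x).hasDerivWithinAt)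
    intro x hx
    rw [interior_Ici] at hx
    exact (hv' x hx).1
  refine ⟨hFd, hFm, hv', hva, ?_⟩
  intro R hR
  have e : v R ^ q * (R ^ (N + γ) / (N + γ)) = ∫ s in (0:ℝ)..R, s ^ (N - 1 + γ) * v R ^ q := by
    rw [intervalIntegral.integral_mul_const, integral_rpow (Or.inl (by linarith))]
    rw [show N - 1 + γ + 1 = N + γ by ring, Real.zero_rpow (by linarith)]
    ring
  rw [e, hF]
  apply intervalIntegral.integral_mono_on hR.le
  · exact ((continuous_id.rpow_const fun x => Or.inr (by linarith)).mul
      continuous_const).intervalIntegrable _ _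
  · exact hfc.intervalIntegrable _ _
  · intro x hx
    apply mul_le_mul_of_nonneg_left _ (Real.rpow_nonneg hx.1 _)
    exact Real.rpow_le_rpow (hpos R) (hva (mem_Ici.2 hx.1) (mem_Ici.2 hR.le) hx.2) (by linarith)

lemma pohozaev_deriv (N p γ q : ℝ) (hp : 1 < p) (hpN : p < N) (hγ : 0 ≤ γ) (hq₁ : p - 1 < q)
    (v v' : ℝ → ℝ) (hv : ∀ r, HasDerivAt v (v' r) r) (hpos : ∀ r, 0 ≤ v r)
    (F : ℝ → ℝ) 
    (hFd : ∀ r, HasDerivAt F (r ^ (N - 1 + γ) * v r ^ q) r)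
    (hv' : ∀ r, 0 < r → v' r ≤ 0 ∧ r ^ (N - 1) * |v' r| ^ (p - 1) = F r) (r : ℝ) (hr : 0 < r) :
    HasDerivAt (fun r => (p - 1) / p * (r ^ N * |v' r| ^ p) + r ^ (N + γ) * v r ^ (q + 1) / (q + 1)
      - (N - p) / p * (F r * v r))
      (((N + γ) / (q + 1) - (N - p) / p) * (r ^ (N + γ - 1) * v r ^ (q + 1))) r := by
  have hG : ∀ r, 0 < r → F r * r ^ (1 - N) = |v' r| ^ (p - 1) := by
    intro r hr
    rw [← (hv' r hr).2, mul_right_comm, ← Real.rpow_add hr]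
    simp
  have hm : ∀ r, 0 < r → r ^ N * |v' r| ^ p = r ^ N * (F r * r ^ (1 - N)) ^ (p / (p - 1)) := by
    intro r hr
    rw [hG r hr, ← Real.rpow_mul (abs_nonneg _), mul_div_cancel₀ _ (by linarith)]
  have hGd : HasDerivAt (fun r => F r * r ^ (1 - N))
      (r ^ γ * v r ^ q + (1 - N) * (|v' r| ^ (p - 1) / r)) r := by
    have := (hFd r).mul (Real.hasDerivAt_rpow_const (p := 1 - N) (Or.inl hr.ne'))
    refine HasDerivAt.congr_deriv this (Eq.symm ?_)
    rw [← hG r hr, Real.rpow_sub_one hr.ne', mul_right_comm, ← Real.rpow_add hr]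
    rw [show N - 1 + γ + (1 - N) = γ by ring]
    ring
  have h1 : HasDerivAt (fun r => r ^ N * |v' r| ^ p) (N * r ^ (N - 1) * |v' r| ^ p +
      r ^ N * ((r ^ γ * v r ^ q + (1 - N) * (|v' r| ^ (p - 1) / r)) * (p / (p - 1)) * |v' r|)) r := by
    have := (Real.hasDerivAt_rpow_const (p := N) (Or.inl hr.ne')).mul
      (hGd.rpow_const (p := p / (p - 1)) (Or.inr (by rw [le_div_iff₀] <;> linarith)))
    rw [hG r hr, ← Real.rpow_mul (abs_nonneg _), ← Real.rpow_mul (abs_nonneg _),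
      mul_div_cancel₀ _ (by linarith),
      show (p - 1) * (p / (p - 1) - 1) = 1 by
        have : p - 1 ≠ 0 := by linarith
        field_simp; ring, Real.rpow_one] at this
    refine this.congr_of_eventuallyEq ?_
    filter_upwards [lt_mem_nhds hr] with s hs
    exact hm s hs
  have h2 : HasDerivAt (fun r => r ^ (N + γ) * v r ^ (q + 1) / (q + 1))
     (((N + γ) * r ^ (N + γ - 1) * v r ^ (q + 1) + r ^ (N + γ) * (v' r * (q + 1) * v r ^ q)) / (q + 1)) r := by
    have := ((Real.hasDerivAt_rpow_const (p := N + γ) (Or.inl hr.ne')).mul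
      ((hv r).rpow_const (p := q + 1) (Or.inr (by linarith)))).div_const (q + 1)
    rwa [add_sub_cancel_right] at this
  have h3 := ((h1.const_mul ((p - 1) / p)).add h2).sub
    (((hFd r).mul (hv r)).const_mul ((N - p) / p))
  refine HasDerivAt.congr_deriv h3 (Eq.symm ?_)
  have hvv : v' r = - |v' r| := by rw [abs_of_nonpos (hv' r hr).1]; ring
  have hFr := (hv' r hr).2
  have e1 : |v' r| ^ p = |v' r| ^ (p - 1) * |v' r| := by
    rw [← Real.rpow_add_one' (abs_nonneg _) (by linarith), sub_add_cancel]
  have e2 : v r ^ (q + 1) = v r ^ q * v r := Real.rpow_add_one' (hpos r) (by linarith)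
  have e3 : r ^ N = r ^ (N - 1) * r := by
    rw [← Real.rpow_add_one hr.ne', sub_add_cancel]
  have e4 : r ^ (N + γ) = r ^ (N - 1) * r * r ^ γ := by rw [Real.rpow_add hr, e3]
  have e5 : r ^ (N + γ - 1) = r ^ (N - 1) * r ^ γ := by
    rw [← Real.rpow_add hr]; congr 1; ring
  have e6 : r ^ (N - 1 + γ) = r ^ (N - 1) * r ^ γ := by
    rw [← Real.rpow_add hr]
  rw [← hFr, hvv, abs_neg, abs_abs, e1, e2, e4, e5, e6, e3]
  have : p - 1 ≠ 0 := by linarith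
  have : q + 1 ≠ 0 := by linarith
  have : p ≠ 0 := by linarith
  field_simp
  ring

lemma ode_liouville (N p γ q : ℝ) (hp : 1 < p) (hpN : p < N) (hγ : 0 ≤ γ) (hq₁ : p - 1 < q)
    (hq₂ : q < ((N + γ) * (p - 1) + p + γ) / (N - p))
    (v v' : ℝ → ℝ) (hv : ∀ r, HasDerivAt v (v' r) r) (hv'c : Continuous v') (hpos : ∀ r, 0 ≤ v r)
    (F : ℝ → ℝ) (hF : ∀ r, F r = ∫ s in (0:ℝ)..r, s ^ (N - 1 + γ) * v s ^ q)
    (hode : ∀ r, 0 < r → r ^ (N - 1) * (|v' r| ^ (p - 2) * v' r) = - F r) :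
    ∀ r, 0 < r → v r = 0 := by
  obtain ⟨hFd, hFm, hv', hva, hlow⟩ := ode_basic N p γ q hp hpN hγ hq₁ v v' hv hpos F hF hode
  have hE := pohozaev_deriv N p γ q hp hpN hγ hq₁ v v' hv hpos F hFd hv'
  have hvc : Continuous v := continuous_iff_continuousAt.2 fun r => (hv r).continuousAt
  have hFc : Continuous F := continuous_iff_continuousAt.2 fun r => (hFd r).continuousAt
  set E : ℝ → ℝ := fun r => (p - 1) / p * (r ^ N * |v' r| ^ p) + r ^ (N + γ) * v r ^ (q + 1) / (q + 1)
      - (N - p) / p * (F r * v r) with hEdef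
  have hEc : Continuous E := by
    have a1 : Continuous fun r : ℝ => r ^ N := continuous_id.rpow_const fun x => Or.inr (by linarith)
    have a2 : Continuous fun r : ℝ => |v' r| ^ p := hv'c.abs.rpow_const fun x => Or.inr (by linarith)
    have a3 : Continuous fun r : ℝ => r ^ (N + γ) :=
      continuous_id.rpow_const fun x => Or.inr (by linarith)
    have a4 : Continuous fun r : ℝ => v r ^ (q + 1) := hvc.rpow_const fun x => Or.inr (by linarith)
    fun_prop
  have hsub : (N - p) * (q + 1) < p * (N + γ) := by
    rw [lt_div_iff₀ (by linarith)] at hq₂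
    nlinarith
  have hc : 0 < (N + γ) / (q + 1) - (N - p) / p := by
    rw [sub_pos, div_lt_div_iff₀ (by linarith) (by linarith)]
    linarith
  by_contra hcon
  push Not at hcon
  obtain ⟨r₁, hr₁, hvr⟩ := hcon
  have hvr : 0 < v r₁ := lt_of_le_of_ne (hpos _) hvr.symm
  have hE0 : E 0 = 0 := by
    have : F 0 = 0 := by rw [hF]; simp
    simp only [hEdef, this]
    rw [Real.zero_rpow (by linarith), Real.zero_rpow (by linarith)]; simp
  have hE1 : 0 < E r₁ := by
    have : StrictMonoOn E (Icc 0 r₁) := by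
      apply strictMonoOn_of_hasDerivWithinAt_pos (convex_Icc 0 r₁) hEc.continuousOn
      · intro x hx
        rw [interior_Icc] at hx
        exact (hE x hx.1).hasDerivWithinAt
      · intro x hx
        rw [interior_Icc] at hx
        have h1 := hva (mem_Ici.2 hx.1.le) (mem_Ici.2 hr₁.le) hx.2.le
        have : 0 < v x := by linarith
        have := hx.1
        positivity
    rw [← hE0]
    exact this ⟨le_rfl, hr₁.le⟩ ⟨hr₁.le, le_rfl⟩ hr₁
  have hEm : MonotoneOn E (Ici 0) := by
    apply monotoneOn_of_hasDerivWithinAt_nonneg (convex_Ici 0) hEc.continuousOn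
    · intro x hx
      rw [interior_Ici] at hx
      exact (hE x hx).hasDerivWithinAt
    · intro x hx
      rw [interior_Ici] at hx
      have h1 := hpos x
      have : 0 < x := hx
      positivity
  -- decay
  set A := (N + γ) * 2 ^ (N - 1) with hA
  have hApos : 0 < A := by
    have : 0 < N + γ := by linarith
    positivity
  set α := (p + γ) / (q - p + 1) with hα
  set B := A ^ (1 / (q - p + 1)) with hB
  have hBpos : 0 < B := by positivity
  have hξ : ∀ R, 0 < R → ∃ ξ ∈ Ioo R (2 * R), |v' ξ| * R ≤ v R := by
    intro R hR
    obtain ⟨ξ, hξ, h⟩ := exists_hasDerivAt_eq_slope v v' (show R < 2 * R by linarith)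
      hvc.continuousOn (fun x _ => hv x)
    refine ⟨ξ, hξ, ?_⟩
    rw [abs_of_nonpos (hv' ξ (by linarith [hξ.1])).1, h]
    have := hpos (2 * R)
    rw [show 2 * R - R = R by ring, ← neg_mul_eq_neg_mul, div_mul_cancel₀ _ hR.ne']
    linarith
  have hdecay : ∀ R, 0 < R → v R ≤ B * R ^ (-α) := by
    intro R hR
    rcases (hpos R).eq_or_lt with h0 | h0
    · rw [← h0]; positivity
    obtain ⟨ξ, hξ, h⟩ := hξ R hR
    have hξ0 : 0 < ξ := by linarith [hξ.1]
    have h1 : F R ≤ F ξ := hFm (mem_Ici.2 hR.le) (mem_Ici.2 hξ0.le) hξ.1.le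
    rw [← (hv' ξ hξ0).2] at h1
    have h2 : ξ ^ (N - 1) * |v' ξ| ^ (p - 1) ≤ (2 * R) ^ (N - 1) * (v R / R) ^ (p - 1) := by
      apply mul_le_mul
      · exact Real.rpow_le_rpow hξ0.le hξ.2.le (by linarith)
      · apply Real.rpow_le_rpow (abs_nonneg _) _ (by linarith)
        rwa [le_div_iff₀ hR]
      · positivity
      · positivity
    have h3 := (hlow R hR).trans (h1.trans h2)
    rw [Real.mul_rpow (by norm_num) hR.le, Real.div_rpow h0.le hR.le] at h3
    have e1 : v R ^ q = v R ^ (q - p + 1) * v R ^ (p - 1) := by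
      rw [← Real.rpow_add h0]; congr 1; ring
    have e2 : R ^ (N + γ) = R ^ (N - 1) * R ^ (p + γ) / R ^ (p - 1) := by
      rw [← Real.rpow_add hR, ← Real.rpow_sub hR]; congr 1; ring
    have h4 : v R ^ (q - p + 1) ≤ A * R ^ (-(p + γ)) := by
      rw [e1, e2] at h3
      rw [Real.rpow_neg hR.le, ← div_eq_mul_inv, le_div_iff₀ (by positivity)]
      have hNγ : 0 < N + γ := by linarith
      have : 0 < v R ^ (p - 1) * R ^ (N - 1) / R ^ (p - 1) / (N + γ) := by positivity
      refine le_of_mul_le_mul_right ?_ this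
      rw [hA]
      convert h3 using 1
      · ring
      · field_simp
    have h5 := Real.rpow_le_rpow (by positivity) h4 (show 0 ≤ 1 / (q - p + 1) by
      apply div_nonneg <;> linarith)
    rw [← Real.rpow_mul h0.le, mul_one_div_cancel (by linarith), Real.rpow_one,
      Real.mul_rpow hApos.le (by positivity), ← Real.rpow_mul hR.le] at h5
    convert h5 using 3
    rw [hα]; ring
  have hα1 : N - α * p - p < 0 := by
    have : N - p < α * p := by
      rw [hα, div_mul_eq_mul_div, lt_div_iff₀ (by linarith)]
      nlinarith
    linarith
  have hα2 : N + γ - α * (q + 1) < 0 := by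
    have : N + γ < α * (q + 1) := by
      rw [hα, div_mul_eq_mul_div, lt_div_iff₀ (by linarith)]
      nlinarith
    linarith
  have hbound : ∀ R, r₁ ≤ R → E r₁ ≤ (p - 1) / p * (2 ^ N * B ^ p) * R ^ (N - α * p - p) +
      2 ^ (N + γ) * B ^ (q + 1) / (q + 1) * R ^ (N + γ - α * (q + 1)) := by
    intro R hR1
    have hR : 0 < R := by linarith
    obtain ⟨ξ, hξ, h⟩ := hξ R hR
    have hξ0 : 0 < ξ := by linarith [hξ.1]
    refine (hEm (mem_Ici.2 hr₁.le) (mem_Ici.2 hξ0.le) (by linarith [hξ.1])).trans ?_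
    have hd := hdecay R hR
    have g1 : |v' ξ| ≤ B * R ^ (-α - 1) := by
      rw [Real.rpow_sub_one hR.ne', ← mul_div_assoc, le_div_iff₀ hR]
      exact h.trans hd
    have g2 : v ξ ≤ B * R ^ (-α) :=
      (hva (mem_Ici.2 hR.le) (mem_Ici.2 hξ0.le) hξ.1.le).trans hd
    have k1 : ξ ^ N * |v' ξ| ^ p ≤ (2 * R) ^ N * (B * R ^ (-α - 1)) ^ p := by
      apply mul_le_mul
      · exact Real.rpow_le_rpow hξ0.le hξ.2.le (by linarith)
      · exact Real.rpow_le_rpow (abs_nonneg _) g1 (by linarith)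
      · positivity
      · positivity
    have k2 : ξ ^ (N + γ) * v ξ ^ (q + 1) ≤ (2 * R) ^ (N + γ) * (B * R ^ (-α)) ^ (q + 1) := by
      apply mul_le_mul
      · exact Real.rpow_le_rpow hξ0.le hξ.2.le (by linarith)
      · exact Real.rpow_le_rpow (hpos _) g2 (by linarith)
      · exact Real.rpow_nonneg (hpos _) _
      · positivity
    have k3 : 0 ≤ (N - p) / p * (F ξ * v ξ) := by
      have : 0 ≤ F ξ := by rw [← (hv' ξ hξ0).2]; positivity
      have := hpos ξ
      have : 0 ≤ (N - p) / p := div_nonneg (by linarith) (by linarith)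
      positivity
    have j1 : (2 * R) ^ N * (B * R ^ (-α - 1)) ^ p = (2 ^ N * B ^ p) * R ^ (N - α * p - p) := by
      rw [Real.mul_rpow (by norm_num) hR.le, Real.mul_rpow hBpos.le (by positivity),
        ← Real.rpow_mul hR.le, show N - α * p - p = N + (-α - 1) * p by ring, Real.rpow_add hR]
      ring
    have j2 : (2 * R) ^ (N + γ) * (B * R ^ (-α)) ^ (q + 1) =
        2 ^ (N + γ) * B ^ (q + 1) * R ^ (N + γ - α * (q + 1)) := by
      rw [Real.mul_rpow (by norm_num) hR.le, Real.mul_rpow hBpos.le (by positivity),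
        ← Real.rpow_mul hR.le, show N + γ - α * (q + 1) = (N + γ) + (-α) * (q + 1) by ring,
        Real.rpow_add hR (N + γ)]
      ring
    rw [j1] at k1
    rw [j2] at k2
    have l1 := mul_le_mul_of_nonneg_left k1 (show 0 ≤ (p - 1) / p from
      div_nonneg (by linarith) (by linarith))
    have l2 := div_le_div_of_nonneg_right k2 (show 0 ≤ q + 1 by linarith)
    have l3 : 2 ^ (N + γ) * B ^ (q + 1) * R ^ (N + γ - α * (q + 1)) / (q + 1) =
      2 ^ (N + γ) * B ^ (q + 1) / (q + 1) * R ^ (N + γ - α * (q + 1)) := by ring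
    simp only [hEdef]
    linarith
  have hlim : Tendsto (fun R : ℝ => (p - 1) / p * (2 ^ N * B ^ p) * R ^ (N - α * p - p) +
      2 ^ (N + γ) * B ^ (q + 1) / (q + 1) * R ^ (N + γ - α * (q + 1))) atTop (𝓝 0) := by
    have t1 := tendsto_rpow_neg_atTop (show 0 < -(N - α * p - p) by linarith)
    have t2 := tendsto_rpow_neg_atTop (show 0 < -(N + γ - α * (q + 1)) by linarith)
    simp only [neg_neg] at t1 t2
    simpa using (t1.const_mul ((p - 1) / p * (2 ^ N * B ^ p))).add
      (t2.const_mul (2 ^ (N + γ) * B ^ (q + 1) / (q + 1)))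
  have := ge_of_tendsto hlim ((eventually_ge_atTop r₁).mono hbound)
  linarith

open scoped RealInnerProductSpace

lemma cont_plap (p : ℝ) (hp : 1 < p) : Continuous fun t : ℝ => |t| ^ (p - 2) * t := by
  rw [continuous_iff_continuousAt]
  intro t
  by_cases ht : t = 0
  · subst ht
    have h1 : Tendsto (fun t : ℝ => |t| ^ (p - 1)) (𝓝 0) (𝓝 0) := by
      have : Continuous fun t : ℝ => |t| ^ (p - 1) :=
        continuous_abs.rpow_const fun x => Or.inr (by linarith)
      have h := this.tendsto 0
      simpa [Real.zero_rpow (show p - 1 ≠ 0 by linarith)] using h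
    have : Tendsto (fun t : ℝ => |t| ^ (p - 2) * t) (𝓝 0) (𝓝 0) := by
      refine squeeze_zero_norm (fun t => ?_) h1
      rw [Real.norm_eq_abs, abs_mul, abs_of_nonneg (Real.rpow_nonneg (abs_nonneg t) _)]
      rw [← Real.rpow_add_one' (abs_nonneg t) (by linarith)]
      rw [show p - 2 + 1 = p - 1 by ring]
    simpa [ContinuousAt] using this
  · exact (continuous_abs.continuousAt.rpow_const (Or.inl (abs_ne_zero.2 ht))).mul continuousAt_id

lemma hasGradientAt_radial {E : Type*} [NormedAddCommGroup E] [InnerProductSpace ℝ E]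
    [CompleteSpace E] (g : ℝ → ℝ) (g' : ℝ) (x : E) (hx : x ≠ 0) (hg : HasDerivAt g g' ‖x‖) :
    HasGradientAt (fun x => g ‖x‖) (g' • (‖x‖⁻¹ • x)) x := by
  have h1 : HasFDerivAt (fun x : E => ‖x‖) (‖x‖⁻¹ • innerSL ℝ x) x := by
    have h := ((hasStrictFDerivAt_norm_sq x).hasFDerivAt).sqrt (by simpa using hx)
    simp only [Real.sqrt_sq (norm_nonneg _)] at h
    convert h using 1
    ext y
    simp
    field_simp
  rw [hasGradientAt_iff_hasFDerivAt]
  refine (hg.comp_hasFDerivAt x h1).congr_fderiv ?_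
  ext y
  simp [inner_smul_left]

lemma weak_to_int
    (N : ℕ) (p γ q : ℝ) (hp : 1 < p) (hpN : p < N) (hγ : 0 ≤ γ)
    (u : EuclideanSpace ℝ (Fin N) → ℝ)
    (v v' : ℝ → ℝ) (hv : ∀ r, HasDerivAt v (v' r) r) 
    (huv : ∀ x : EuclideanSpace ℝ (Fin N), u x = v ‖x‖)
    (hweak : ∀ φ : EuclideanSpace ℝ (Fin N) → ℝ,
      ContDiff ℝ (⊤ : ℕ∞) φ → HasCompactSupport φ →
      ∫ x, ‖gradient u x‖ ^ (p - 2) * ⟪gradient u x, gradient φ x⟫ =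
        ∫ x, ‖x‖ ^ γ * u x ^ q * φ x)
    (k g : ℝ → ℝ) (hg : ∀ r, HasDerivAt g (k r) r) (hgs : ContDiff ℝ (⊤ : ℕ∞) g)
    (b : ℝ) (hgb : ∀ r, b ≤ r → g r = 0) (ε : ℝ) (hε : 0 < ε) (hgε : ∀ r, r < ε → g r = g 0) :
    ∫ r in Ioi (0:ℝ), r ^ ((N:ℝ) - 1) * (|v' r| ^ (p - 2) * v' r) * k r =
      ∫ r in Ioi (0:ℝ), r ^ ((N:ℝ) - 1 + γ) * v r ^ q * g r := by
  have hN : 1 < (N:ℝ) := by linarith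
  have hN' : 1 < N := by exact_mod_cast hN
  have : Nonempty (Fin N) := ⟨⟨0, by omega⟩⟩
  have : Nontrivial (EuclideanSpace ℝ (Fin N)) := inferInstance
  have hφ : ContDiff ℝ (⊤ : ℕ∞) fun x : EuclideanSpace ℝ (Fin N) => g ‖x‖ := by
    rw [contDiff_iff_contDiffAt]
    intro x
    by_cases hx : x = 0
    · subst hx
      refine (contDiffAt_const (c := g 0)).congr_of_eventuallyEq ?_
      filter_upwards [ball_mem_nhds 0 hε] with y hy
      exact hgε _ (by simpa using hy)
    · exact hgs.contDiffAt.comp x (contDiffAt_norm ℝ hx)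
  have hφc : HasCompactSupport fun x : EuclideanSpace ℝ (Fin N) => g ‖x‖ := by
    refine HasCompactSupport.intro (isCompact_closedBall 0 b) fun x hx => ?_
    apply hgb
    simp at hx
    exact hx.le
  have h := hweak _ hφ hφc
  have hL : ∫ x, ‖gradient u x‖ ^ (p - 2) * ⟪gradient u x, gradient (fun x => g ‖x‖) x⟫ =
      ∫ x : EuclideanSpace ℝ (Fin N), (fun r => |v' r| ^ (p - 2) * v' r * k r) ‖x‖ := by
    apply integral_congr_ae
    have : ∀ᵐ x : EuclideanSpace ℝ (Fin N), x ≠ 0 := by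
      exact (Set.countable_singleton 0).ae_notMem volume
    filter_upwards [this] with x hx
    have hxn : ‖x‖ ≠ 0 := norm_ne_zero_iff.2 hx
    have g1 := (hasGradientAt_radial v _ x hx (hv _)).gradient
    have g2 := (hasGradientAt_radial g _ x hx (hg _)).gradient
    have g3 : u = fun x => v ‖x‖ := funext huv
    rw [g3, g1, g2]
    have hun : ‖(‖x‖⁻¹ • x)‖ = 1 := by
      rw [norm_smul, norm_inv, norm_norm, inv_mul_cancel₀ hxn]
    rw [norm_smul, hun, inner_smul_left, inner_smul_right, real_inner_self_eq_norm_sq, hun]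
    simp
    ring
  have hR : ∫ x, ‖x‖ ^ γ * u x ^ q * g ‖x‖ =
      ∫ x : EuclideanSpace ℝ (Fin N), (fun r => r ^ γ * v r ^ q * g r) ‖x‖ := by
    simp only [huv]
  rw [hL, hR, 
    integral_fun_norm_addHaar volume (fun r => |v' r| ^ (p - 2) * v' r * k r),
    integral_fun_norm_addHaar volume (fun r => r ^ γ * v r ^ q * g r)] at h
  have hc : 0 < (volume : Measure (EuclideanSpace ℝ (Fin N))).real (ball 0 1) :=
    ENNReal.toReal_pos (measure_ball_pos _ _ one_pos).ne' measure_ball_lt_top.ne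
  simp only [finrank_euclideanSpace, Fintype.card_fin, nsmul_eq_mul, smul_eq_mul] at h
  have h := mul_left_cancel₀ hc.ne' (mul_left_cancel₀ (by linarith : (N:ℝ) ≠ 0) h)
  have e : ∀ r : ℝ, 0 < r → r ^ (N - 1) = r ^ ((N:ℝ) - 1) := by
    intro r hr
    rw [← Real.rpow_natCast, Nat.cast_sub hN'.le, Nat.cast_one]
  convert h using 1
  · apply setIntegral_congr_fun measurableSet_Ioi
    intro r hr
    simp only [e r hr]
    ring
  · apply setIntegral_congr_fun measurableSet_Ioi
    intro r hr
    simp only [e r hr]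
    rw [Real.rpow_add hr]
    ring

lemma int_to_ode (f F W : ℝ → ℝ) (hf : Continuous f) (hF : ∀ r, F r = ∫ s in (0:ℝ)..r, f s)
    (hW : Continuous W)
    (h : ∀ (k g : ℝ → ℝ), (∀ r, HasDerivAt g (k r) r) → (ContDiff ℝ (⊤ : ℕ∞) g) →
      ∀ b : ℝ, (∀ r, b ≤ r → g r = 0) → ∀ ε : ℝ, 0 < ε → (∀ r, r < ε → g r = g 0) →
      ∫ r in Ioi (0:ℝ), W r * k r = ∫ r in Ioi (0:ℝ), f r * g r) :
    ∀ r, 0 < r → W r = - F r := by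
  have hFd : ∀ r, HasDerivAt F (f r) r := by
    intro r
    have : F = fun r => ∫ s in (0:ℝ)..r, f s := funext hF
    rw [this]
    exact hf.integral_hasStrictDerivAt 0 r |>.hasDerivAt
  have hFc : Continuous F := continuous_iff_continuousAt.2 fun r => (hFd r).continuousAt
  have hF0 : F 0 = 0 := by rw [hF]; simp
  have hae : ∀ᵐ r : ℝ, r ∈ Ioi (0:ℝ) → W r + F r = 0 := by
    apply isOpen_Ioi.ae_eq_zero_of_integral_contDiff_smul_eq_zero
      (f := fun r => W r + F r)
    · exact (hW.add hFc).locallyIntegrable.locallyIntegrableOn _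
    intro k hk hkc hks
    have hk0 : ∀ r, r ≤ 0 → k r = 0 := by
      intro r hr
      apply image_eq_zero_of_notMem_tsupport
      intro h
      exact absurd (hks h) (by simpa using hr)
    obtain ⟨ε, hε, hkε⟩ : ∃ ε > 0, ∀ r, r < ε → k r = 0 := by
      have : (tsupport k)ᶜ ∈ 𝓝 (0:ℝ) := (isClosed_tsupport k).isOpen_compl.mem_nhds
        (fun h => absurd (hks h) (by simp))
      obtain ⟨ε, hε, hb⟩ := Metric.mem_nhds_iff.1 this
      refine ⟨ε, hε, fun r hr => ?_⟩
      rcases le_or_gt r 0 with h0 | h0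
      · exact hk0 r h0
      · apply image_eq_zero_of_notMem_tsupport
        apply hb
        simp [abs_of_pos h0, hr]
    obtain ⟨b, hb0, hkb⟩ : ∃ b > 0, ∀ r, b < r → k r = 0 := by
      obtain ⟨b, hb⟩ := hkc.isCompact.bddAbove
      refine ⟨max b 1, by positivity, fun r hr => ?_⟩
      apply image_eq_zero_of_notMem_tsupport
      intro h
      have := hb h
      have := le_max_left b 1
      linarith
    have hkcont : Continuous k := hk.continuous
    set g : ℝ → ℝ := fun r => ∫ s in b..r, k s with hgdef
    have hgd : ∀ r, HasDerivAt g (k r) r := fun r =>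
      (hkcont.integral_hasStrictDerivAt b r).hasDerivAt
    have hgs : ContDiff ℝ (⊤ : ℕ∞) g := by
      rw [contDiff_infty_iff_deriv]
      refine ⟨fun r => (hgd r).differentiableAt, ?_⟩
      rw [show deriv g = k from funext fun r => (hgd r).deriv]
      exact hk
    have hgb : ∀ r, b ≤ r → g r = 0 := by
      intro r hr
      simp only [hgdef]
      apply intervalIntegral.integral_zero_ae
      refine ae_of_all _ fun x hx => hkb x ?_
      rw [uIoc_of_le hr] at hx
      exact hx.1
    have hgε : ∀ r, r < ε → g r = g 0 := by
      intro r hr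
      have : g r - g 0 = ∫ s in (0:ℝ)..r, k s := by
        simp only [hgdef]
        rw [intervalIntegral.integral_interval_sub_left] <;> exact hkcont.intervalIntegrable _ _
      rw [← sub_eq_zero, this]
      apply intervalIntegral.integral_zero_ae
      refine ae_of_all _ fun x hx => hkε x ?_
      have := hx.2
      exact lt_of_le_of_lt this (max_lt hε hr)
    have key := h k g hgd hgs b hgb ε hε hgε
    have hgc : Continuous g := hgs.continuous
    have conv : ∀ G : ℝ → ℝ, (∀ r, b < r → G r = 0) →
        ∫ r in Ioi (0:ℝ), G r = ∫ r in (0:ℝ)..b, G r := by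
      intro G hG
      rw [intervalIntegral.integral_of_le hb0.le]
      symm
      apply (setIntegral_eq_of_subset_of_forall_sdiff_eq_zero measurableSet_Ioi
        Ioc_subset_Ioi_self _).symm
      intro x hx
      apply hG
      by_contra hc
      exact hx.2 ⟨hx.1, not_lt.1 hc⟩
    rw [conv _ (fun r hr => by rw [hkb r hr, mul_zero]),
      conv _ (fun r hr => by rw [hgb r hr.le, mul_zero])] at key
    have ibp := intervalIntegral.integral_deriv_mul_eq_sub
      (a := 0) (b := b) (u := F) (v := g) (u' := f) (v' := k)
      (fun x _ => hFd x) (fun x _ => hgd x) (hf.intervalIntegrable _ _)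
      (hkcont.intervalIntegrable _ _)
    rw [hgb b le_rfl, hF0, intervalIntegral.integral_add (f := fun x => f x * g x)
      (g := fun x => F x * k x)
      ((hf.mul hgc).intervalIntegrable _ _) ((hFc.mul hkcont).intervalIntegrable _ _)] at ibp
    have e1 : ∫ r, k r • (W r + F r) = ∫ r in Ioi (0:ℝ), k r • (W r + F r) := by
      symm
      apply setIntegral_eq_integral_of_forall_compl_eq_zero
      intro x hx
      rw [hk0 x (by simpa using hx), zero_smul]
    rw [e1, conv _ (fun r hr => by rw [hkb r hr, zero_smul])]
    have e2 : ∫ r in (0:ℝ)..b, k r • (W r + F r) =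
        (∫ r in (0:ℝ)..b, W r * k r) + ∫ r in (0:ℝ)..b, F r * k r := by
      rw [← intervalIntegral.integral_add (f := fun r => W r * k r) (g := fun r => F r * k r)
        ((hW.mul hkcont).intervalIntegrable _ _)
        ((hFc.mul hkcont).intervalIntegrable _ _)]
      congr 1
      ext r
      simp; ring
    rw [e2]
    linarith
  have hae' : (fun r => W r + F r) =ᵐ[volume.restrict (Ioi (0:ℝ))] fun _ => 0 := by
    rw [Filter.EventuallyEq, ae_restrict_iff' measurableSet_Ioi]
    exact hae
  have := Measure.eqOn_open_of_ae_eq hae' isOpen_Ioi (hW.add hFc).continuousOn continuousOn_const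
  intro r hr
  have := this hr
  simp only at this
  linarith
end Helpers

open MeasureTheory Metric
open scoped RealInnerProductSpace

/-- Liouville theorem for radial solutions of the equation `-Δ_p u = |x|^γ u^q` in `ℝ^N`
when `p - 1 < q < ((N+γ)(p-1)+p+γ)/(N-p)` and `γ ≥ 0`. -/
theorem liouville_radial_equation
    (N : ℕ) (p γ q : ℝ) (hp : 1 < p) (hpN : p < N) (hγ : 0 ≤ γ)
    (hq₁ : p - 1 < q)
    (hq₂ : q < (((N : ℝ) + γ) * (p - 1) + p + γ) / ((N : ℝ) - p))
    (u : EuclideanSpace ℝ (Fin N) → ℝ)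
    (hu : ContDiff ℝ 1 u) (hu_nonneg : ∀ x, 0 ≤ u x)
    (V : ℝ → ℝ) (hrad : ∀ x : EuclideanSpace ℝ (Fin N), u x = V ‖x‖)
    (hweak : ∀ φ : EuclideanSpace ℝ (Fin N) → ℝ,
      ContDiff ℝ (⊤ : ℕ∞) φ → HasCompactSupport φ →
      ∫ x, ‖gradient u x‖ ^ (p - 2) * ⟪gradient u x, gradient φ x⟫ =
        ∫ x, ‖x‖ ^ γ * u x ^ q * φ x) :
    ∀ x, u x = 0 := by
  have hN : 1 < (N:ℝ) := by linarith
  have hN' : 1 < N := by exact_mod_cast hN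
  obtain ⟨e, he⟩ : ∃ e : EuclideanSpace ℝ (Fin N), ‖e‖ = 1 :=
    ⟨EuclideanSpace.single ⟨0, by omega⟩ 1, by simp⟩
  set v : ℝ → ℝ := fun r => u (r • e) with hvdef
  set v' : ℝ → ℝ := fun r => fderiv ℝ u (r • e) e with hv'def
  have hv : ∀ r, HasDerivAt v (v' r) r := by
    intro r
    have h1 : HasDerivAt (fun r : ℝ => r • e) e r := by
      simpa using (hasDerivAt_id r).smul_const e
    exact ((hu.differentiable (by norm_num)) (r • e)).hasFDerivAt.comp_hasDerivAt r h1
  have hv'c : Continuous v' := by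
    have := hu.continuous_fderiv (by norm_num)
    exact (this.comp (continuous_id.smul continuous_const)).clm_apply continuous_const
  have hvc : Continuous v := continuous_iff_continuousAt.2 fun r => (hv r).continuousAt
  have hpos : ∀ r, 0 ≤ v r := fun r => hu_nonneg _
  have huv : ∀ x : EuclideanSpace ℝ (Fin N), u x = v ‖x‖ := by
    intro x
    simp only [hvdef]
    rw [hrad x, hrad (‖x‖ • e), norm_smul, norm_norm, he, mul_one]
  have hfc : Continuous fun s : ℝ => s ^ ((N:ℝ) - 1 + γ) * v s ^ q :=
    (continuous_id.rpow_const fun x => Or.inr (by linarith)).mul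
      (hvc.rpow_const fun x => Or.inr (by linarith))
  have hWc : Continuous fun r : ℝ => r ^ ((N:ℝ) - 1) * (|v' r| ^ (p - 2) * v' r) :=
    (continuous_id.rpow_const fun x => Or.inr (by linarith)).mul ((cont_plap p hp).comp hv'c)
  have hode := int_to_ode _ (fun r => ∫ s in (0:ℝ)..r, s ^ ((N:ℝ) - 1 + γ) * v s ^ q) _ hfc
    (fun r => rfl) hWc
    (fun k g hg hgs b hgb ε hε hgε => weak_to_int N p γ q hp hpN hγ u v v' hv huv hweak
      k g hg hgs b hgb ε hε hgε)
  have hz := ode_liouville N p γ q hp hpN hγ hq₁ hq₂ v v' hv hv'c hpos _ (fun r => rfl) hode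
  have hz0 : v 0 = 0 := by
    have h1 : Filter.Tendsto v (nhdsWithin 0 (Set.Ioi 0)) (nhds (v 0)) :=
      (hvc.tendsto 0).mono_left nhdsWithin_le_nhds
    have h2 : Filter.Tendsto v (nhdsWithin 0 (Set.Ioi 0)) (nhds 0) := by
      refine tendsto_const_nhds.congr' ?_
      filter_upwards [self_mem_nhdsWithin] with r hr
      exact (hz r hr).symm
    exact tendsto_nhds_unique h1 h2
  intro x
  rw [huv x]
  rcases (norm_nonneg x).eq_or_lt with h | h
  · rw [← h]; exact hz0
  · exact hz _ h
end

section
/- Let N > p > 1, let C₁ > 0 and r₁ > 1, and let β be a real number with β = 1 if p ≤ 2, and 0 < β < 1/(p−1) if p > 2. Suppose u : ℝ^N → ℝ is a nonnegative continuous function, C¹ on {x : |x| > r₁}, positive there, and satisfying ∫ |∇u(x)|^{p−2}⟨∇u(x), ∇φ(x)⟩ dx ≥ ∫ C₁ |x|^{−N} φ(x) dx for every nonnegative C^∞ function φ compactly supported in {x : |x| > r₁}. Then there exist R₁ ≥ r₁ and c > 0 such that u(x) ≥ c |x|^{(p−N)/(p−1)} (log|x|)^β for all |x| ≥ R₁.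 -/
open MeasureTheory Metric
open scoped RealInnerProductSpace

section helpers
variable {E : Type*} [NormedAddCommGroup E] [InnerProductSpace ℝ E]

/-- the `p`-Laplace vector field -/
noncomputable def pField (p : ℝ) (a : E) : E := ‖a‖ ^ (p - 2) • a

lemma norm_pow_aux (p : ℝ) (hp : 1 < p) (a : E) : ‖a‖ ^ (p - 2) * ‖a‖ = ‖a‖ ^ (p - 1) := by
  rcases eq_or_ne a 0 with rfl | h
  · simp [Real.zero_rpow (by linarith : p - 1 ≠ 0)]
  · have h' : 0 < ‖a‖ := norm_pos_iff.2 h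
    rw [show p - 1 = (p - 2) + 1 by ring, Real.rpow_add h', Real.rpow_one]

lemma pField_mono (p : ℝ) (hp : 1 < p) (a b : E) :
    0 ≤ ⟪pField p a - pField p b, a - b⟫ := by
  unfold pField
  have h1 := norm_pow_aux p hp a
  have h2 := norm_pow_aux p hp b
  simp only [inner_sub_left, inner_sub_right, real_inner_smul_left, real_inner_self_eq_norm_sq]
  rw [real_inner_comm a b]
  have hab := real_inner_le_norm a b
  have ha : 0 ≤ ‖a‖ ^ (p - 2) := by positivity
  have hb : 0 ≤ ‖b‖ ^ (p - 2) := by positivity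
  have key : 0 ≤ (‖a‖ ^ (p - 1) - ‖b‖ ^ (p - 1)) * (‖a‖ - ‖b‖) := by
    rcases le_total ‖a‖ ‖b‖ with h | h
    · have := Real.rpow_le_rpow (norm_nonneg _) h (by linarith : 0 ≤ p - 1)
      nlinarith
    · have := Real.rpow_le_rpow (norm_nonneg _) h (by linarith : 0 ≤ p - 1)
      nlinarith
  rw [← h1, ← h2] at key
  rw [real_inner_comm b a] at *
  nlinarith [mul_le_mul_of_nonneg_left hab ha, mul_le_mul_of_nonneg_left hab hb]

lemma pField_continuous [CompleteSpace E] (p : ℝ) (hp : 1 < p) :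
    Continuous (pField p : E → E) := by
  have h := (contDiff_norm_rpow (E := E) hp).continuous_fderiv one_ne_zero
  have h2 : Continuous fun a : E => p⁻¹ • (InnerProductSpace.toDual ℝ E).symm
      (fderiv ℝ (fun x : E => ‖x‖ ^ p) a) := by fun_prop
  convert h2 using 2 with a
  rw [fderiv_norm_rpow a hp, pField, map_smul]
  have : (InnerProductSpace.toDual ℝ E).symm (innerSL ℝ a) = a :=
    (InnerProductSpace.toDual ℝ E).symm_apply_apply a
  rw [this, smul_smul]
  congr 1
  field_simp

end helpers

section moll
variable {E : Type*} [NormedAddCommGroup E] [InnerProductSpace ℝ E] [FiniteDimensional ℝ E]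
  [MeasurableSpace E] [BorelSpace E]

lemma exists_mollify (φ : E → ℝ) (hφ : ContDiff ℝ 1 φ) (hc : HasCompactSupport φ)
    (h0 : ∀ x, 0 ≤ φ x) {δ ε : ℝ} (hδ : 0 < δ) (hε : 0 < ε) :
    ∃ ψ : E → ℝ, ContDiff ℝ (⊤ : ℕ∞) ψ ∧ tsupport ψ ⊆ cthickening δ (tsupport φ) ∧
      (∀ x, 0 ≤ ψ x) ∧ (∀ x, |ψ x - φ x| ≤ ε) ∧ ∀ x, ‖fderiv ℝ ψ x - fderiv ℝ φ x‖ ≤ ε := by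
  have hφc := hφ.continuous
  have hdc : Continuous (fderiv ℝ φ) := hφ.continuous_fderiv one_ne_zero
  have u1 := hc.uniformContinuous_of_continuous hφc
  have u2 := (hc.fderiv (𝕜 := ℝ)).uniformContinuous_of_continuous hdc
  obtain ⟨d1, hd1, H1⟩ := Metric.uniformContinuous_iff.1 u1 ε hε
  obtain ⟨d2, hd2, H2⟩ := Metric.uniformContinuous_iff.1 u2 ε hε
  set d := min δ (min d1 d2) with hd
  have hd0 : 0 < d := by positivity
  let ρ : ContDiffBump (0 : E) := ⟨d / 2, d, by positivity, by linarith⟩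
  have hL : LocallyIntegrable φ (volume : Measure E) := hφc.locallyIntegrable
  refine ⟨convolution (ρ.normed volume) φ (ContinuousLinearMap.lsmul ℝ ℝ) volume, ?_, ?_, ?_, ?_, ?_⟩
  · exact ρ.hasCompactSupport_normed.contDiff_convolution_left _ ρ.contDiff_normed hL
  · refine closure_minimal ?_ isClosed_cthickening
    refine (support_convolution_subset _).trans ?_
    rintro _ ⟨a, ha, b, hb, rfl⟩
    rw [ρ.support_normed_eq] at ha
    refine mem_cthickening_of_dist_le _ b _ _ (subset_closure hb) ?_
    have : ‖a‖ < d := by simpa using ha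
    simp only [dist_eq_norm, add_sub_cancel_right]
    exact this.le.trans (min_le_left _ _)
  · intro x
    exact integral_nonneg fun y => mul_nonneg (ρ.nonneg_normed _) (h0 _)
  · intro x
    have := ρ.dist_normed_convolution_le (μ := volume) (g := φ) (x₀ := x) (ε := ε)
      hφc.aestronglyMeasurable (fun y hy => (H1 (lt_of_lt_of_le hy
        ((min_le_right _ _).trans (min_le_left _ _)))).le)
    simpa [Real.dist_eq] using this
  · intro x
    have h1 := hc.hasFDerivAt_convolution_right (ContinuousLinearMap.lsmul ℝ ℝ)
      (ρ.continuous_normed (μ := volume)).locallyIntegrable hφ x (μ := volume)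
    rw [h1.fderiv]
    have := ρ.dist_normed_convolution_le (μ := volume) (g := fderiv ℝ φ) (x₀ := x) (ε := ε)
      hdc.aestronglyMeasurable (fun y hy => (H2 (lt_of_lt_of_le hy
        ((min_le_right _ _).trans (min_le_right _ _)))).le)
    rw [dist_eq_norm] at this
    have heq : convolution (ρ.normed volume) (fderiv ℝ φ)
        ((ContinuousLinearMap.lsmul ℝ ℝ : ℝ →L[ℝ] ℝ →L[ℝ] ℝ).precompR E) volume x =
        convolution (ρ.normed volume) (fderiv ℝ φ) (ContinuousLinearMap.lsmul ℝ ℝ) volume x := by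
      unfold convolution
      refine integral_congr_ae (Filter.Eventually.of_forall fun t => ?_)
      ext v
      simp
    rw [heq]
    exact this

end moll

lemma euler_ibp (N : ℕ) (V : EuclideanSpace ℝ (Fin N) → ℝ) (hV : ContDiff ℝ 1 V)
    (hc : HasCompactSupport V) : ∫ x, fderiv ℝ V x x = -(N * ∫ x, V x) := by
  have hdc : Continuous (fderiv ℝ V) := hV.continuous_fderiv one_ne_zero
  have hcd := hc.fderiv (𝕜 := ℝ)
  have hVc := hV.continuous
  have hI : Integrable V := hVc.integrable_of_hasCompactSupport hc
  let b := fun i : Fin N => EuclideanSpace.single i (1 : ℝ)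
  have hfd : ∀ (i : Fin N) x, HasFDerivAt (fun x : EuclideanSpace ℝ (Fin N) => x i)
      (EuclideanSpace.proj i : EuclideanSpace ℝ (Fin N) →L[ℝ] ℝ) x := fun i x =>
    (EuclideanSpace.proj (𝕜 := ℝ) i).hasFDerivAt
  have hint : ∀ i, Integrable (fun x : EuclideanSpace ℝ (Fin N) => x i * fderiv ℝ V x (b i)) := by
    intro i
    refine Continuous.integrable_of_hasCompactSupport (by fun_prop) ?_
    refine hcd.mono ?_
    intro x hx h
    exact hx (by simp [h])
  have hi : ∀ i, ∫ x : EuclideanSpace ℝ (Fin N), x i * fderiv ℝ V x (b i) = - ∫ x, V x := by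
    intro i
    have := integral_mul_fderiv_eq_neg_fderiv_mul_of_integrable (μ := volume)
      (f := fun x : EuclideanSpace ℝ (Fin N) => x i) (g := V) (v := b i) ?_ (hint i) ?_
      (fun x _ => (hfd i x).differentiableAt) (fun x _ => hV.differentiable one_ne_zero x)
    · rw [this]
      congr 2
      ext x
      rw [(hfd i x).fderiv]; simp [b]
    · refine hI.congr (Filter.Eventually.of_forall fun x => ?_)
      simp only
      rw [(hfd i x).fderiv]; simp [b]
    · refine Continuous.integrable_of_hasCompactSupport (by fun_prop) ?_
      exact hc.mul_left
  have hsum : ∀ x, fderiv ℝ V x x = ∑ i, x i * fderiv ℝ V x (b i) := by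
    intro x
    generalize fderiv ℝ V x = L
    conv_lhs => rw [← (EuclideanSpace.basisFun (Fin N) ℝ).sum_repr x]
    simp [b]
  simp_rw [hsum]
  rw [integral_finsetSum _ (fun i _ => hint i)]
  simp [hi]

section weak
variable {E : Type*} [NormedAddCommGroup E] [InnerProductSpace ℝ E] [FiniteDimensional ℝ E]
  [MeasurableSpace E] [BorelSpace E]

lemma weak_extend {Ω : Set E} (hΩ : IsOpen Ω) (X : E → E) (hX : ContinuousOn X Ω)
    (f : E → ℝ) (hf : ContinuousOn f Ω)
    (hweak : ∀ φ : E → ℝ, ContDiff ℝ (⊤ : ℕ∞) φ → HasCompactSupport φ → tsupport φ ⊆ Ω →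
      (∀ x, 0 ≤ φ x) → ∫ x, f x * φ x ≤ ∫ x, fderiv ℝ φ x (X x))
    (φ : E → ℝ) (hφ : ContDiff ℝ 1 φ) (hc : HasCompactSupport φ) (hs : tsupport φ ⊆ Ω)
    (h0 : ∀ x, 0 ≤ φ x) : ∫ x, f x * φ x ≤ ∫ x, fderiv ℝ φ x (X x) := by
  obtain ⟨δ, hδ, hδs⟩ := IsCompact.exists_cthickening_subset_open hc hΩ hs
  set K := cthickening δ (tsupport φ) with hK
  have hKc : IsCompact K := IsCompact.cthickening hc
  have hφK : tsupport φ ⊆ K := self_subset_cthickening _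
  have hpos : ∀ n : ℕ, (0 : ℝ) < 1 / ((n : ℝ) + 1) := fun n => by positivity
  choose ψ hψ hψs hψ0 hψ1 hψ2 using fun n : ℕ => exists_mollify φ hφ hc h0 hδ (hpos n)
  have hfin : volume K ≠ ⊤ := hKc.measure_lt_top.ne
  have z1 : ∀ η : E → ℝ, tsupport η ⊆ K → ∫ x, f x * η x = ∫ x in K, f x * η x := by
    intro η hη
    refine (setIntegral_eq_integral_of_forall_compl_eq_zero fun x hx => ?_).symm
    rw [image_eq_zero_of_notMem_tsupport (fun h => hx (hη h)), mul_zero]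
  have z2 : ∀ η : E → ℝ, tsupport η ⊆ K →
      ∫ x, fderiv ℝ η x (X x) = ∫ x in K, fderiv ℝ η x (X x) := by
    intro η hη
    refine (setIntegral_eq_integral_of_forall_compl_eq_zero fun x hx => ?_).symm
    rw [fderiv_of_notMem_tsupport ℝ (fun h => hx (hη h))]
    rfl
  have hdc : Continuous (fderiv ℝ φ) := hφ.continuous_fderiv one_ne_zero
  obtain ⟨B1, hB1⟩ := hKc.exists_bound_of_continuousOn (hf.mono hδs)
  obtain ⟨B2, hB2⟩ := hKc.exists_bound_of_continuousOn (hX.mono hδs)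
  obtain ⟨M1, hM1⟩ := hKc.exists_bound_of_continuousOn hφ.continuous.continuousOn
  obtain ⟨M2, hM2⟩ := hKc.exists_bound_of_continuousOn hdc.continuousOn
  have hle1 : ∀ n : ℕ, (1 : ℝ) / ((n : ℝ) + 1) ≤ 1 := fun n => by
    rw [div_le_one (by positivity)]; linarith [(Nat.cast_nonneg n : (0 : ℝ) ≤ n)]
  have hKm : MeasurableSet K := isClosed_cthickening.measurableSet
  have t1 : Filter.Tendsto (fun n => ∫ x in K, f x * ψ n x) Filter.atTop
      (nhds (∫ x in K, f x * φ x)) := by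
    refine tendsto_integral_of_dominated_convergence (fun _ => B1 * (M1 + 1)) ?_ ?_ ?_ ?_
    · intro n
      exact ((hf.mono hδs).mul (hψ n).continuous.continuousOn).aestronglyMeasurable hKm
    · exact integrableOn_const hfin
    · intro n
      refine ae_restrict_of_forall_mem hKm fun x hx => ?_
      rw [norm_mul]
      refine mul_le_mul (hB1 x hx) ?_ (norm_nonneg _) ((norm_nonneg _).trans (hB1 x hx))
      have h1 := (hψ1 n x).trans (hle1 n)
      have h2 := hM1 x hx
      calc ‖ψ n x‖ = ‖φ x + (ψ n x - φ x)‖ := by congr 1; ring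
        _ ≤ ‖φ x‖ + ‖ψ n x - φ x‖ := norm_add_le _ _
        _ ≤ _ := add_le_add h2 h1
    · refine ae_restrict_of_forall_mem hKm fun x hx => ?_
      refine Filter.Tendsto.const_mul _ ?_
      rw [tendsto_iff_norm_sub_tendsto_zero]
      exact squeeze_zero (fun _ => norm_nonneg _) (fun n => hψ1 n x)
        tendsto_one_div_add_atTop_nhds_zero_nat
  have t2 : Filter.Tendsto (fun n => ∫ x in K, fderiv ℝ (ψ n) x (X x)) Filter.atTop
      (nhds (∫ x in K, fderiv ℝ φ x (X x))) := by
    refine tendsto_integral_of_dominated_convergence (fun _ => (M2 + 1) * B2) ?_ ?_ ?_ ?_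
    · intro n
      have : Continuous (fderiv ℝ (ψ n)) := (hψ n).continuous_fderiv (by simp)
      exact (this.continuousOn.clm_apply (hX.mono hδs)).aestronglyMeasurable hKm
    · exact integrableOn_const hfin
    · intro n
      refine ae_restrict_of_forall_mem hKm fun x hx => ?_
      have h1 := (hψ2 n x).trans (hle1 n)
      have h2 := hM2 x hx
      have h3 : ‖fderiv ℝ (ψ n) x‖ ≤ M2 + 1 := by
        calc ‖fderiv ℝ (ψ n) x‖ = ‖fderiv ℝ φ x + (fderiv ℝ (ψ n) x - fderiv ℝ φ x)‖ := by
              congr 1; abel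
          _ ≤ ‖fderiv ℝ φ x‖ + ‖fderiv ℝ (ψ n) x - fderiv ℝ φ x‖ := norm_add_le _ _
          _ ≤ _ := add_le_add h2 h1
      refine (ContinuousLinearMap.le_opNorm _ _).trans ?_
      exact mul_le_mul h3 (hB2 x hx) (norm_nonneg _) ((norm_nonneg _).trans h3)
    · refine ae_restrict_of_forall_mem hKm fun x hx => ?_
      have : Filter.Tendsto (fun n => fderiv ℝ (ψ n) x) Filter.atTop (nhds (fderiv ℝ φ x)) := by
        rw [tendsto_iff_norm_sub_tendsto_zero]
        exact squeeze_zero (fun _ => norm_nonneg _) (fun n => hψ2 n x)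
          tendsto_one_div_add_atTop_nhds_zero_nat
      exact ((ContinuousLinearMap.apply ℝ ℝ (X x)).continuous.tendsto _).comp this
  rw [z1 φ hφK, z2 φ hφK]
  refine le_of_tendsto_of_tendsto' t1 t2 fun n => ?_
  rw [← z1 _ (hψs n), ← z2 _ (hψs n)]
  exact hweak _ (hψ n) (hKc.of_isClosed_subset (isClosed_tsupport _) (hψs n))
    ((hψs n).trans hδs) (hψ0 n)

lemma integrable_of_contOn {Ω : Set E} (h : E → ℝ) (hh : ContinuousOn h Ω) {K : Set E}
    (hK : IsCompact K) (hKΩ : K ⊆ Ω) (hz : ∀ x, x ∉ K → h x = 0) : Integrable h := by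
  rw [← integrableOn_iff_integrable_of_support_subset (s := K)]
  · exact (hh.mono hKΩ).integrableOn_compact hK
  · intro x hx
    by_contra h'
    exact hx (hz x h')

lemma hasFDerivAt_norm_aux (x : E) (hx : x ≠ 0) :
    HasFDerivAt (fun y : E => ‖y‖) (‖x‖⁻¹ • innerSL ℝ x) x := by
  have h0 : ‖x‖ ≠ 0 := norm_ne_zero_iff.2 hx
  have h := (hasStrictFDerivAt_norm_sq x).hasFDerivAt.sqrt (by positivity)
  simp only [Real.sqrt_sq (norm_nonneg _)] at h
  convert h using 1
  ext y
  simp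
  field_simp

lemma hasFDerivAt_radial (G : ℝ → ℝ) (G' : ℝ) (x : E) (hx : x ≠ 0) (hG : HasDerivAt G G' ‖x‖) :
    HasFDerivAt (fun y : E => G ‖y‖) ((G' * ‖x‖⁻¹) • innerSL ℝ x) x := by
  have := hG.comp_hasFDerivAt x (hasFDerivAt_norm_aux x hx)
  rwa [smul_smul] at this

end weak

lemma flux_ibp (N : ℕ) (φ : EuclideanSpace ℝ (Fin N) → ℝ) (hφ : ContDiff ℝ 1 φ)
    (hc : HasCompactSupport φ) (hs : tsupport φ ⊆ {x | 1 < ‖x‖}) :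
    ∫ x, (‖x‖ ^ (-(N : ℝ)) * Real.log ‖x‖) * fderiv ℝ φ x x =
      - ∫ x, ‖x‖ ^ (-(N : ℝ)) * φ x := by
  have hne : ∀ x : EuclideanSpace ℝ (Fin N), 1 < ‖x‖ → x ≠ 0 := by
    rintro x hx rfl
    simp at hx; linarith
  have hΩ : IsOpen {x : EuclideanSpace ℝ (Fin N) | 1 < ‖x‖} := isOpen_lt continuous_const continuous_norm
  let ψ : ℝ → ℝ := fun r => r ^ (-(N : ℝ)) * Real.log r
  have hψ : ∀ r : ℝ, 1 < r → HasDerivAt ψ ((-(N : ℝ) * r ^ (-(N : ℝ)) * Real.log r + r ^ (-(N : ℝ))) * r⁻¹) r := by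
    intro r hr
    have hr0 : r ≠ 0 := by linarith
    have := (Real.hasDerivAt_rpow_const (x := r) (p := -(N : ℝ)) (Or.inl hr0)).mul
      (Real.hasDerivAt_log hr0)
    refine this.congr_deriv ?_
    rw [Real.rpow_sub_one hr0]
    field_simp
  let V : EuclideanSpace ℝ (Fin N) → ℝ := fun x => ψ ‖x‖ * φ x
  have hcn : ContinuousOn (fun x : EuclideanSpace ℝ (Fin N) => ‖x‖ ^ (-(N : ℝ))) {x | 1 < ‖x‖} := by
    intro x hx
    exact (continuous_norm.continuousAt.rpow_const (Or.inl (norm_ne_zero_iff.2 (hne x hx)))).continuousWithinAt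
  have hVsub : tsupport V ⊆ tsupport φ := by
    refine closure_mono ?_
    intro x hx h
    exact hx (by simp [V, h])
  have hV : ContDiff ℝ 1 V := by
    rw [contDiff_iff_contDiffAt]
    intro x
    by_cases hx : x ∈ tsupport φ
    · have h1 := hs hx
      have hx0 := hne x h1
      have hn : ContDiffAt ℝ 1 (fun y : EuclideanSpace ℝ (Fin N) => ‖y‖) x := contDiffAt_norm ℝ hx0
      have hn0 := norm_ne_zero_iff.2 hx0
      exact ((hn.rpow_const_of_ne hn0).mul (hn.log hn0)).mul hφ.contDiffAt
    · have : V =ᶠ[nhds x] fun _ => 0 := by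
        filter_upwards [(isClosed_tsupport φ).isOpen_compl.mem_nhds hx] with y hy
        simp [V, image_eq_zero_of_notMem_tsupport hy]
      exact contDiffAt_const.congr_of_eventuallyEq this
  have hVc : HasCompactSupport V := IsCompact.of_isClosed_subset hc (isClosed_tsupport _) hVsub
  have e := euler_ibp N V hV hVc
  have hI1 : Integrable (fun x => fderiv ℝ V x x) := by
    refine integrable_of_contOn (Ω := Set.univ) _ ?_ hVc (Set.subset_univ _) ?_
    · exact ((hV.continuous_fderiv one_ne_zero).clm_apply continuous_id).continuousOn
    · intro x hx
      rw [fderiv_of_notMem_tsupport ℝ hx]; rfl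
  have hI2 : Integrable V := hV.continuous.integrable_of_hasCompactSupport hVc
  have hI3 : Integrable (fun x => ‖x‖ ^ (-(N : ℝ)) * φ x) := by
    refine integrable_of_contOn (Ω := {x | 1 < ‖x‖}) _ (hcn.mul hφ.continuous.continuousOn) hc hs ?_
    intro x hx
    rw [image_eq_zero_of_notMem_tsupport hx, mul_zero]
  have key : ∀ x : EuclideanSpace ℝ (Fin N), (‖x‖ ^ (-(N : ℝ)) * Real.log ‖x‖) * fderiv ℝ φ x x =
      fderiv ℝ V x x + N * V x - ‖x‖ ^ (-(N : ℝ)) * φ x := by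
    intro x
    by_cases hx : x ∈ tsupport φ
    · have h1 : 1 < ‖x‖ := hs hx
      have hx0 := hne x h1
      have hn0 := norm_ne_zero_iff.2 hx0
      have hd := (hasFDerivAt_radial ψ _ x hx0 (hψ _ h1)).mul
        (hφ.differentiable one_ne_zero x).hasFDerivAt
      have hd' : HasFDerivAt V _ x := hd
      rw [hd'.fderiv]
      simp [V, ψ]
      field_simp
      ring
    · rw [fderiv_of_notMem_tsupport ℝ hx, fderiv_of_notMem_tsupport ℝ (fun h => hx (hVsub h))]
      simp [V, image_eq_zero_of_notMem_tsupport hx]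
  simp_rw [key]
  have hI4 : Integrable (fun x => fderiv ℝ V x x + N * V x) := hI1.add (hI2.const_mul _)
  rw [integral_sub hI4 hI3, integral_add hI1 (hI2.const_mul _), e,
    integral_const_mul]
  ring

/-- radial profile: minus the derivative of the barrier -/
noncomputable def prof (a γ s : ℝ) : ℝ := (max s 1) ^ a * Real.log (max s 1) ^ γ

lemma prof_cont (a γ : ℝ) (hγ : 0 < γ) : Continuous (prof a γ) := by
  unfold prof
  have h1 : Continuous fun s : ℝ => max s 1 := by fun_prop
  have h2 : ∀ s : ℝ, max s 1 ≠ 0 := fun s => by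
    have := le_max_right s 1; positivity
  exact (h1.rpow_const fun s => Or.inl (h2 s)).mul
    ((h1.log h2).rpow_const fun s => Or.inr hγ.le)

lemma prof_nonneg (a γ s : ℝ) : 0 ≤ prof a γ s := by
  unfold prof
  have h := le_max_right s 1
  exact mul_nonneg (Real.rpow_nonneg (by linarith) _) (Real.rpow_nonneg (Real.log_nonneg h) _)

lemma prof_eq (a γ s : ℝ) (hs : 1 ≤ s) : prof a γ s = s ^ a * Real.log s ^ γ := by
  simp [prof, max_eq_left hs]

lemma prof_bdd (a γ : ℝ) (hγ : 0 < γ) (ha : a < -1) (R : ℝ) (hR : 1 < R) :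
    ∃ M : ℝ, 0 < M ∧ ∀ T, R ≤ T → ∫ s in R..T, prof a γ s ≤ M := by
  set e := (-1 - a) / 2 with he
  have he0 : 0 < e := by rw [he]; linarith
  have hint : IntegrableOn (prof a γ) (Set.Ioi R) := by
    have h1 : IntegrableOn (fun s : ℝ => (γ / e) ^ γ * s ^ (a + e)) (Set.Ioi R) :=
      (integrableOn_Ioi_rpow_of_lt (by rw [he]; linarith) (by linarith)).const_mul _
    refine Integrable.mono' h1 (prof_cont a γ hγ).aestronglyMeasurable ?_
    refine ae_restrict_of_forall_mem measurableSet_Ioi fun s hs => ?_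
    have hs1 : 1 < s := hR.trans hs
    have hs0 : 0 < s := by linarith
    rw [Real.norm_of_nonneg (prof_nonneg _ _ _), prof_eq _ _ _ hs1.le]
    have hl := Real.log_le_rpow_div hs0.le (div_pos he0 hγ)
    have hl2 : Real.log s ^ γ ≤ (γ / e) ^ γ * s ^ e := by
      calc Real.log s ^ γ ≤ (s ^ (e / γ) / (e / γ)) ^ γ :=
            Real.rpow_le_rpow (Real.log_nonneg hs1.le) hl hγ.le
        _ = ((γ / e) * s ^ (e / γ)) ^ γ := by congr 1; field_simp
        _ = (γ / e) ^ γ * s ^ e := by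
            rw [Real.mul_rpow (by positivity) (by positivity), ← Real.rpow_mul hs0.le]
            congr 2; field_simp
    calc s ^ a * Real.log s ^ γ ≤ s ^ a * ((γ / e) ^ γ * s ^ e) := by gcongr
      _ = _ := by rw [Real.rpow_add hs0]; ring
  refine ⟨(∫ s in Set.Ioi R, prof a γ s) + 1, ?_, ?_⟩
  · have : 0 ≤ ∫ s in Set.Ioi R, prof a γ s := integral_nonneg fun s => prof_nonneg _ _ _
    linarith
  · intro T hT
    rw [intervalIntegral.integral_of_le hT]
    have := setIntegral_mono_set hint (Filter.Eventually.of_forall fun s => prof_nonneg a γ s)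
      (show Set.Ioc R T ⊆ Set.Ioi R from Set.Ioc_subset_Ioi_self).eventuallyLE
    linarith

lemma barrier_deriv (a γ κ T : ℝ) (hγ : 0 < γ) (r : ℝ) :
    HasDerivAt (fun r => κ * ∫ s in r..T, prof a γ s) (-(κ * prof a γ r)) r := by
  have h := ((prof_cont a γ hγ).integral_hasStrictDerivAt T r).hasDerivAt
  have h2 := (h.const_mul (-κ))
  refine (h2.congr_deriv (by ring)).congr_of_eventuallyEq (Filter.Eventually.of_forall fun y => ?_)
  simp only
  rw [intervalIntegral.integral_symm]; ring

lemma barrier_contDiff (a γ κ T : ℝ) (hγ : 0 < γ) :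
    ContDiff ℝ 1 (fun r => κ * ∫ s in r..T, prof a γ s) := by
  rw [contDiff_one_iff_deriv]
  refine ⟨fun r => (barrier_deriv a γ κ T hγ r).differentiableAt, ?_⟩
  have : deriv (fun r => κ * ∫ s in r..T, prof a γ s) = fun r => -(κ * prof a γ r) :=
    funext fun r => (barrier_deriv a γ κ T hγ r).deriv
  rw [this]
  exact ((prof_cont a γ hγ).const_mul κ).neg

lemma pField_barrier {E : Type*} [NormedAddCommGroup E] [InnerProductSpace ℝ E]
    (N : ℕ) (p κ : ℝ) (hp : 1 < p) (hκ : 0 < κ) (x : E) (hx : 1 < ‖x‖) :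
    pField p ((-(κ * prof (-(((N : ℝ) - 1) / (p - 1))) (1 / (p - 1)) ‖x‖) * ‖x‖⁻¹) • x) =
      (-(κ ^ (p - 1) * (‖x‖ ^ (-(N : ℝ)) * Real.log ‖x‖))) • x := by
  have hp1 : 0 < p - 1 := by linarith
  have hr : 0 < ‖x‖ := by linarith
  have hl : 0 < Real.log ‖x‖ := Real.log_pos hx
  rw [prof_eq _ _ _ hx.le]
  set r := ‖x‖ with hrdef
  set b := r ^ (-(((N : ℝ) - 1) / (p - 1))) * Real.log r ^ (1 / (p - 1)) with hb
  have hb0 : 0 < b := by positivity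
  have hbp : b ^ (p - 1) = r ^ (-(N : ℝ)) * r * Real.log r := by
    rw [hb, Real.mul_rpow (by positivity) (by positivity), ← Real.rpow_mul hr.le,
      ← Real.rpow_mul hl.le]
    have h1 : -(((N : ℝ) - 1) / (p - 1)) * (p - 1) = -(N : ℝ) + 1 := by field_simp; ring
    have h2 : 1 / (p - 1) * (p - 1) = 1 := by field_simp
    rw [h1, h2, Real.rpow_add hr, Real.rpow_one, Real.rpow_one]
  have hn : ‖(-(κ * b) * r⁻¹) • x‖ = κ * b := by
    rw [norm_smul, ← hrdef, norm_mul, norm_neg, Real.norm_of_nonneg (by positivity),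
      Real.norm_of_nonneg (by positivity)]
    field_simp
  unfold pField
  rw [hn, smul_smul]
  congr 1
  have h3 : (κ * b) ^ (p - 1) = (κ * b) ^ (p - 2) * (κ * b) := by
    rw [show p - 1 = p - 2 + 1 by ring, Real.rpow_add (by positivity), Real.rpow_one]
  have h4 : (κ * b) ^ (p - 1) = κ ^ (p - 1) * (r ^ (-(N : ℝ)) * r * Real.log r) := by
    rw [Real.mul_rpow hκ.le hb0.le, hbp]
  calc (κ * b) ^ (p - 2) * (-(κ * b) * r⁻¹) = -((κ * b) ^ (p - 2) * (κ * b)) * r⁻¹ := by ring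
    _ = _ := by rw [← h3, h4]; field_simp

lemma comparison (N : ℕ) (p : ℝ) (hp : 1 < p)
    (C₁ r₁ : ℝ) (hr₁ : 1 < r₁)
    (u : EuclideanSpace ℝ (Fin N) → ℝ)
    (hu_cont : Continuous u) (hu_nonneg : ∀ x, 0 ≤ u x)
    (hu_C1 : ContDiffOn ℝ 1 u {x : EuclideanSpace ℝ (Fin N) | r₁ < ‖x‖})
    (hweak : ∀ φ : EuclideanSpace ℝ (Fin N) → ℝ,
      ContDiff ℝ (⊤ : ℕ∞) φ → HasCompactSupport φ →
      tsupport φ ⊆ {x : EuclideanSpace ℝ (Fin N) | r₁ < ‖x‖} → (∀ x, 0 ≤ φ x) →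
      ∫ x, C₁ * ‖x‖ ^ (-(N : ℝ)) * φ x ≤
        ∫ x, ‖gradient u x‖ ^ (p - 2) * ⟪gradient u x, gradient φ x⟫)
    (κ R T : ℝ) (hκ : 0 < κ) (hκC : κ ^ (p - 1) < C₁) (hR : r₁ < R)
    (hbd : ∀ x : EuclideanSpace ℝ (Fin N), ‖x‖ = R →
      κ * ∫ s in ‖x‖..T, prof (-(((N : ℝ) - 1) / (p - 1))) (1 / (p - 1)) s < u x)
    (x₀ : EuclideanSpace ℝ (Fin N)) (hx₀ : R < ‖x₀‖) :
    κ * ∫ s in ‖x₀‖..T, prof (-(((N : ℝ) - 1) / (p - 1))) (1 / (p - 1)) s ≤ u x₀ := by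
  by_contra hcon
  push Not at hcon
  have hγ : 0 < 1 / (p - 1) := by have : 0 < p - 1 := by linarith
                                  positivity
  set a := -(((N : ℝ) - 1) / (p - 1)) with ha
  set γ := 1 / (p - 1) with hγdef
  set Ω := {x : EuclideanSpace ℝ (Fin N) | r₁ < ‖x‖} with hΩdef
  have hΩ : IsOpen Ω := isOpen_lt continuous_const continuous_norm
  have hne : ∀ x : EuclideanSpace ℝ (Fin N), r₁ < ‖x‖ → x ≠ 0 := by
    rintro x hx rfl
    simp at hx; linarith
  let G : ℝ → ℝ := fun r => κ * ∫ s in r..T, prof a γ s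
  have hGc : ContDiff ℝ 1 G := barrier_contDiff a γ κ T hγ
  let D : EuclideanSpace ℝ (Fin N) → ℝ := fun x => G ‖x‖ - u x
  have hDcont : Continuous D := (hGc.continuous.comp continuous_norm).sub hu_cont
  let φ : EuclideanSpace ℝ (Fin N) → ℝ := fun x => if R < ‖x‖ then expNegInvGlue (D x) else 0
  have hin : ∀ x, R < ‖x‖ → φ =ᶠ[nhds x] fun y => expNegInvGlue (D y) := by
    intro x hx
    filter_upwards [(isOpen_lt continuous_const continuous_norm).mem_nhds hx] with y hy
    exact if_pos hy
  have hout : ∀ x, ‖x‖ ≤ R → φ =ᶠ[nhds x] fun _ => 0 := by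
    intro x hx
    rcases hx.lt_or_eq with h | h
    · filter_upwards [(isOpen_lt continuous_norm continuous_const).mem_nhds h] with y hy
      exact if_neg (not_lt.2 (le_of_lt hy))
    · have hD : D x < 0 := sub_neg.2 (hbd x h)
      filter_upwards [(isOpen_lt hDcont continuous_const).mem_nhds hD] with y hy
      simp only [φ]
      rw [expNegInvGlue.zero_of_nonpos (le_of_lt hy), ite_self]
  have hnormC1 : ∀ x, r₁ < ‖x‖ → ContDiffAt ℝ 1 (fun y : EuclideanSpace ℝ (Fin N) => G ‖y‖) x :=
    fun x hx => hGc.contDiffAt.comp x (contDiffAt_norm ℝ (hne x hx))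
  have huC1 : ∀ x, r₁ < ‖x‖ → ContDiffAt ℝ 1 u x := fun x hx =>
    hu_C1.contDiffAt (hΩ.mem_nhds hx)
  have hφ : ContDiff ℝ 1 φ := by
    rw [contDiff_iff_contDiffAt]
    intro x
    rcases lt_or_ge R ‖x‖ with h | h
    · refine ContDiffAt.congr_of_eventuallyEq ?_ (hin x h)
      have h' := hR.trans h
      exact (expNegInvGlue.contDiff (n := 1)).contDiffAt.comp x ((hnormC1 x h').sub (huC1 x h'))
    · exact contDiffAt_const.congr_of_eventuallyEq (hout x h)
  have hφ0 : ∀ x, 0 ≤ φ x := by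
    intro x
    simp only [φ]
    split_ifs
    · exact expNegInvGlue.nonneg _
    · exact le_rfl
  have hsub : tsupport φ ⊆ {x | R ≤ ‖x‖} ∩ closedBall 0 T := by
    refine closure_minimal ?_ ((isClosed_le continuous_const continuous_norm).inter isClosed_closedBall)
    intro x hx
    have h1 : R < ‖x‖ := by
      by_contra h
      exact hx (if_neg h)
    refine ⟨h1.le, ?_⟩
    rw [mem_closedBall_zero_iff]
    by_contra h
    push Not at h
    refine hx ?_
    simp only [φ, if_pos h1]
    apply expNegInvGlue.zero_of_nonpos
    have h2 : ∫ s in ‖x‖..T, prof a γ s ≤ 0 := by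
      rw [intervalIntegral.integral_symm]
      exact neg_nonpos.2 (intervalIntegral.integral_nonneg h.le fun s _ => prof_nonneg _ _ _)
    have h3 : G ‖x‖ ≤ 0 := mul_nonpos_of_nonneg_of_nonpos hκ.le h2
    have := hu_nonneg x
    simp only [D]
    linarith
  have hc : HasCompactSupport φ :=
    (isCompact_closedBall (0 : EuclideanSpace ℝ (Fin N)) T).of_isClosed_subset
      (isClosed_tsupport _) (hsub.trans Set.inter_subset_right)
  have hsΩ : tsupport φ ⊆ Ω := fun x hx => lt_of_lt_of_le hR (hsub hx).1
  have hgu : ContinuousOn (gradient u) Ω := by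
    have : ContinuousOn (fderiv ℝ u) Ω := hu_C1.continuousOn_fderiv_of_isOpen hΩ le_rfl
    exact (InnerProductSpace.toDual ℝ _).symm.continuous.comp_continuousOn this
  have hXu : ContinuousOn (fun x => pField p (gradient u x)) Ω :=
    (pField_continuous p hp).comp_continuousOn hgu
  have hcn : ContinuousOn (fun x : EuclideanSpace ℝ (Fin N) => ‖x‖ ^ (-(N : ℝ))) Ω := by
    intro x hx
    exact (continuous_norm.continuousAt.rpow_const (Or.inl (norm_ne_zero_iff.2 (hne x hx)))).continuousWithinAt
  have hcl : ContinuousOn (fun x : EuclideanSpace ℝ (Fin N) => Real.log ‖x‖) Ω := by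
    intro x hx
    exact (continuous_norm.continuousAt.log (norm_ne_zero_iff.2 (hne x hx))).continuousWithinAt
  have W := weak_extend hΩ (fun x => pField p (gradient u x)) hXu
    (fun x => C₁ * ‖x‖ ^ (-(N : ℝ))) (continuousOn_const.mul hcn) (by
      intro η h1 h2 h3 h4
      refine (hweak η h1 h2 h3 h4).trans (le_of_eq ?_)
      congr 1
      ext x
      rw [pField, map_smul, inner_gradient_right]
      simp) φ hφ hc hsΩ hφ0
  let Xw : EuclideanSpace ℝ (Fin N) → EuclideanSpace ℝ (Fin N) := fun x =>
    (-(κ ^ (p - 1) * (‖x‖ ^ (-(N : ℝ)) * Real.log ‖x‖))) • x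
  have hXw : ContinuousOn Xw Ω :=
    (continuousOn_const.mul (hcn.mul hcl)).neg.smul continuousOn_id
  have hdφ : Continuous (fderiv ℝ φ) := hφ.continuous_fderiv one_ne_zero
  have hIu : Integrable (fun x => fderiv ℝ φ x (pField p (gradient u x))) := by
    refine integrable_of_contOn _ (hdφ.continuousOn.clm_apply hXu) hc hsΩ fun x hx => ?_
    rw [fderiv_of_notMem_tsupport ℝ hx]; rfl
  have hIw : Integrable (fun x => fderiv ℝ φ x (Xw x)) := by
    refine integrable_of_contOn _ (hdφ.continuousOn.clm_apply hXw) hc hsΩ fun x hx => ?_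
    rw [fderiv_of_notMem_tsupport ℝ hx]; rfl
  have hmono : ∀ x, fderiv ℝ φ x (pField p (gradient u x)) ≤ fderiv ℝ φ x (Xw x) := by
    intro x
    rcases lt_or_ge R ‖x‖ with h | h
    · have h' := hR.trans h
      have hx1 : 1 < ‖x‖ := hr₁.trans h'
      have hdG := hasFDerivAt_radial G _ x (hne x h') (barrier_deriv a γ κ T hγ ‖x‖)
      have hdu := ((huC1 x h').differentiableAt one_ne_zero).hasFDerivAt
      have hF : HasDerivAt expNegInvGlue (deriv expNegInvGlue (D x)) (D x) :=
        ((expNegInvGlue.contDiff (n := 1)).differentiable one_ne_zero _).hasDerivAt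
      have hd : HasFDerivAt (fun y => expNegInvGlue (D y)) _ x :=
        hF.comp_hasFDerivAt x (hdG.sub hdu)
      rw [(hin x h).fderiv_eq, hd.fderiv, ← sub_nonneg, ← map_sub]
      have hXx : Xw x = pField p ((-(κ * prof a γ ‖x‖) * ‖x‖⁻¹) • x) :=
        (pField_barrier N p κ hp hκ x hx1).symm
      rw [hXx]
      have hm := pField_mono p hp ((-(κ * prof a γ ‖x‖) * ‖x‖⁻¹) • x) (gradient u x)
      rw [real_inner_comm, inner_sub_left, inner_gradient_left, real_inner_smul_left] at hm
      refine mul_nonneg expNegInvGlue.monotone.deriv_nonneg ?_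
      exact hm
    · rw [(hout x h).fderiv_eq]; simp
  have I1 := integral_mono hIu hIw hmono
  have I2 : ∫ x, fderiv ℝ φ x (Xw x) = κ ^ (p - 1) * ∫ x, ‖x‖ ^ (-(N : ℝ)) * φ x := by
    have := flux_ibp N φ hφ hc (fun x hx => hr₁.trans (hsΩ hx))
    rw [← neg_eq_iff_eq_neg] at this
    rw [← this, ← integral_neg, ← integral_const_mul]
    congr 1
    ext x
    simp only [Xw, map_smul, smul_eq_mul]
    ring
  have hφc : Continuous (fun x => ‖x‖ ^ (-(N : ℝ)) * φ x) := by
    rw [continuous_iff_continuousAt]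
    intro x
    rcases lt_or_ge R ‖x‖ with h | h
    · exact (hcn.continuousAt (hΩ.mem_nhds (hR.trans h))).mul hφ.continuous.continuousAt
    · refine (continuousAt_const (y := (0 : ℝ))).congr ?_
      filter_upwards [hout x h] with y hy
      simp [hy]
  have I3 : 0 < ∫ x, ‖x‖ ^ (-(N : ℝ)) * φ x := by
    refine hφc.integral_pos_of_hasCompactSupport_nonneg_nonzero (x := x₀) hc.mul_left
      (fun x => mul_nonneg (by positivity) (hφ0 x)) ?_
    have h1 : 0 < ‖x₀‖ := by linarith
    have h2 : 0 < φ x₀ := by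
      simp only [φ, if_pos hx₀]
      exact expNegInvGlue.pos_of_pos (sub_pos.2 hcon)
    positivity
  have I4 : ∫ x, C₁ * ‖x‖ ^ (-(N : ℝ)) * φ x = C₁ * ∫ x, ‖x‖ ^ (-(N : ℝ)) * φ x := by
    rw [← integral_const_mul]; simp_rw [mul_assoc]
  rw [I4] at W
  rw [I2] at I1
  nlinarith [W.trans I1, mul_lt_mul_of_pos_right hκC I3]

/-- Logarithmic lower bound on exterior domains. -/
theorem exterior_log_lower_bound
    (N : ℕ) (p : ℝ) (hp : 1 < p) (hpN : p < N)
    (C₁ r₁ β : ℝ) (hC₁ : 0 < C₁) (hr₁ : 1 < r₁)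
    (hβ₁ : p ≤ 2 → β = 1)
    (hβ₂ : 2 < p → 0 < β ∧ β < 1 / (p - 1))
    (u : EuclideanSpace ℝ (Fin N) → ℝ)
    (hu_cont : Continuous u) (hu_nonneg : ∀ x, 0 ≤ u x)
    (hu_C1 : ContDiffOn ℝ 1 u {x : EuclideanSpace ℝ (Fin N) | r₁ < ‖x‖})
    (hu_pos : ∀ x : EuclideanSpace ℝ (Fin N), r₁ < ‖x‖ → 0 < u x)
    (hweak : ∀ φ : EuclideanSpace ℝ (Fin N) → ℝ,
      ContDiff ℝ (⊤ : ℕ∞) φ → HasCompactSupport φ →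
      tsupport φ ⊆ {x : EuclideanSpace ℝ (Fin N) | r₁ < ‖x‖} → (∀ x, 0 ≤ φ x) →
      ∫ x, C₁ * ‖x‖ ^ (-(N : ℝ)) * φ x ≤
        ∫ x, ‖gradient u x‖ ^ (p - 2) * ⟪gradient u x, gradient φ x⟫) :
    ∃ R₁ : ℝ, r₁ ≤ R₁ ∧ ∃ c : ℝ, 0 < c ∧
      ∀ x : EuclideanSpace ℝ (Fin N), R₁ ≤ ‖x‖ →
        c * ‖x‖ ^ ((p - N) / (p - 1)) * Real.log ‖x‖ ^ β ≤ u x := by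
  have hp1 : 0 < p - 1 := by linarith
  set a := -(((N : ℝ) - 1) / (p - 1)) with ha
  set γ := 1 / (p - 1) with hγdef
  have hγ : 0 < γ := by positivity
  have hβγ : β ≤ γ := by
    rcases le_or_gt p 2 with h | h
    · rw [hβ₁ h, hγdef, le_div_iff₀ hp1]; linarith
    · exact (hβ₂ h).2.le
  have ha1 : a < -1 := by
    rw [ha, neg_lt_neg_iff, lt_div_iff₀ hp1]; linarith
  have haα : a + 1 = (p - N) / (p - 1) := by
    rw [ha]; field_simp; ring
  set R := r₁ + 1 with hR
  obtain ⟨M, hM, hMb⟩ := prof_bdd a γ hγ ha1 R (by linarith)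
  obtain ⟨m, hm, hmb⟩ : ∃ m : ℝ, 0 < m ∧ ∀ x : EuclideanSpace ℝ (Fin N), ‖x‖ = R → m ≤ u x := by
    rcases (sphere (0 : EuclideanSpace ℝ (Fin N)) R).eq_empty_or_nonempty with h | h
    · refine ⟨1, one_pos, fun x hx => ?_⟩
      have : x ∈ sphere (0 : EuclideanSpace ℝ (Fin N)) R := by simpa using hx
      rw [h] at this
      exact this.elim
    · obtain ⟨y, hy, hmin⟩ := (isCompact_sphere _ _).exists_isMinOn h hu_cont.continuousOn
      refine ⟨u y, hu_pos y ?_, fun x hx => hmin (by simpa using hx)⟩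
      have : ‖y‖ = R := by simpa using hy
      linarith
  obtain ⟨κ, hκ, hκC, hκM⟩ : ∃ κ : ℝ, 0 < κ ∧ κ ^ (p - 1) < C₁ ∧ κ * M < m := by
    set k1 := (C₁ / 2) ^ (1 / (p - 1)) with hk1
    have hk1p : 0 < k1 := by positivity
    have hk1e : k1 ^ (p - 1) = C₁ / 2 := by
      rw [hk1, ← Real.rpow_mul (by positivity), one_div_mul_cancel hp1.ne', Real.rpow_one]
    refine ⟨min k1 (m / (2 * M)), by positivity, ?_, ?_⟩
    · have := Real.rpow_le_rpow (by positivity) (min_le_left k1 (m / (2 * M))) hp1.le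
      linarith
    · have := mul_le_mul_of_nonneg_right (min_le_right k1 (m / (2 * M))) hM.le
      have h2 : m / (2 * M) * M = m / 2 := by field_simp
      linarith
  refine ⟨max (R + 1) (Real.exp 1), le_trans (by linarith) (le_max_left _ _), κ * 2 ^ a, by positivity, ?_⟩
  intro x hx
  have hxR : R < ‖x‖ := by linarith [le_max_left (R + 1) (Real.exp 1)]
  have hxe : Real.exp 1 ≤ ‖x‖ := (le_max_right _ _).trans hx
  have hr0 : 0 < ‖x‖ := by linarith
  have hr1 : 1 < ‖x‖ := by linarith
  have hlog : 1 ≤ Real.log ‖x‖ := (Real.le_log_iff_exp_le hr0).2 hxe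
  have key := comparison N p hp C₁ r₁ hr₁ u hu_cont hu_nonneg hu_C1 hweak κ R (2 * ‖x‖) hκ hκC
    (by linarith) (by
      intro y hy
      rw [hy]
      calc _ ≤ κ * M := mul_le_mul_of_nonneg_left (hMb _ (by linarith)) hκ.le
        _ < m := hκM
        _ ≤ u y := hmb y hy) x hxR
  refine le_trans ?_ key
  rw [← ha, ← hγdef]
  set r := ‖x‖ with hr
  have hlow : ∀ s ∈ Set.Icc r (2 * r), (2 * r) ^ a * Real.log r ^ γ ≤ prof a γ s := by
    intro s hs
    have hs1 : 1 ≤ s := hr1.le.trans hs.1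
    rw [prof_eq _ _ _ hs1]
    refine mul_le_mul ?_ ?_ (by positivity) (by positivity)
    · exact Real.rpow_le_rpow_of_nonpos (by linarith) hs.2 (by linarith)
    · exact Real.rpow_le_rpow (by linarith) (Real.log_le_log hr0 hs.1) hγ.le
  have hint : r * ((2 * r) ^ a * Real.log r ^ γ) ≤ ∫ s in r..(2 * r), prof a γ s := by
    have := intervalIntegral.integral_mono_on (μ := volume) (by linarith : r ≤ 2 * r)
      (intervalIntegrable_const (c := (2 * r) ^ a * Real.log r ^ γ))
      ((prof_cont a γ hγ).intervalIntegrable _ _) hlow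
    rw [intervalIntegral.integral_const, smul_eq_mul] at this
    linarith
  have hlogb : Real.log r ^ β ≤ Real.log r ^ γ := Real.rpow_le_rpow_of_exponent_le hlog hβγ
  calc κ * 2 ^ a * r ^ ((p - N) / (p - 1)) * Real.log r ^ β
      ≤ κ * 2 ^ a * r ^ ((p - N) / (p - 1)) * Real.log r ^ γ := by gcongr
    _ = κ * (r * ((2 * r) ^ a * Real.log r ^ γ)) := by
        rw [← haα, Real.rpow_add hr0, Real.rpow_one, Real.mul_rpow (by norm_num) hr0.le]; ring
    _ ≤ _ := mul_le_mul_of_nonneg_left hint hκ.le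
end

section
/- Let N > p > 1 and let h : ℝ^N → ℝ be continuous and nonnegative with h(x) = a|x|^γ for all |x| ≥ R₀, where a > 0, γ > −p and R₀ > 0 are constants. Let q > p − 1. If u : ℝ^N → ℝ is a nonnegative C¹ function satisfying ∫_{ℝ^N} |∇u(x)|^{p−2}⟨∇u(x), ∇φ(x)⟩ dx + ∫_{ℝ^N} h(x) u(x)^q φ(x) dx ≤ 0 for every nonnegative C^∞ compactly supported φ : ℝ^N → ℝ, then u ≡ 0. -/
open MeasureTheory Metric
open scoped RealInnerProductSpace

lemma llv_mollify {N : ℕ} (φ : EuclideanSpace ℝ (Fin N) → ℝ) (r : ℝ)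
    (hφ : ContDiff ℝ 1 φ) (hφ0 : ∀ x, 0 ≤ φ x) (hr : ∀ x, r < ‖x‖ → φ x = 0)
    (ε : ℝ) (hε : 0 < ε) :
    ∃ ψ : EuclideanSpace ℝ (Fin N) → ℝ, ContDiff ℝ (⊤ : ℕ∞) ψ ∧ HasCompactSupport ψ ∧
      (∀ x, 0 ≤ ψ x) ∧ (∀ x, r + 1 < ‖x‖ → ψ x = 0) ∧ (∀ x, |φ x - ψ x| ≤ ε) ∧
      ∀ x, ‖fderiv ℝ φ x - fderiv ℝ ψ x‖ ≤ ε := by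
  have hcs : HasCompactSupport φ := by
    refine HasCompactSupport.intro (isCompact_closedBall (0 : EuclideanSpace ℝ (Fin N)) r) ?_
    intro x hx
    exact hr x (by simpa using hx)
  have hc1 : Continuous (fderiv ℝ φ) := hφ.continuous_fderiv (by norm_num)
  have u1 := hcs.uniformContinuous_of_continuous hφ.continuous
  have u2 := (hcs.fderiv (𝕜 := ℝ)).uniformContinuous_of_continuous hc1
  rw [Metric.uniformContinuous_iff] at u1 u2
  obtain ⟨d1, hd1, h1⟩ := u1 ε hε
  obtain ⟨d2, hd2, h2⟩ := u2 ε hε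
  set d := min 1 (min d1 d2) with hd
  have hdpos : 0 < d := by positivity
  let f : ContDiffBump (0 : EuclideanSpace ℝ (Fin N)) := ⟨d / 2, d, by positivity, by linarith⟩
  have hfc : HasCompactSupport (f.normed volume) := f.hasCompactSupport_normed
  have hfs : ContDiff ℝ (⊤ : ℕ∞) (f.normed volume) := f.contDiff_normed
  refine ⟨convolution (f.normed volume) φ (ContinuousLinearMap.lsmul ℝ ℝ) volume, ?_, ?_, ?_, ?_, ?_, ?_⟩
  · exact hfc.contDiff_convolution_left _ hfs hφ.continuous.locallyIntegrable
  · exact hfc.convolution _ hcs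
  · intro x
    refine integral_nonneg fun t => ?_
    simp only [ContinuousLinearMap.lsmul_apply, smul_eq_mul]
    exact mul_nonneg (f.nonneg_normed t) (hφ0 _)
  · intro x hx
    by_contra hne
    have := support_convolution_subset (μ := volume) (ContinuousLinearMap.lsmul ℝ ℝ) (show x ∈ Function.support _ from hne)
    obtain ⟨y, hy, z, hz, rfl⟩ := Set.mem_add.1 this
    rw [f.support_normed_eq] at hy
    have hy' : ‖y‖ < d := by simpa [f] using hy
    have hz' : ‖z‖ ≤ r := by
      by_contra hlt
      exact hz (hr z (not_le.1 hlt))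
    have := norm_add_le y z
    have : d ≤ 1 := min_le_left _ _
    linarith
  · intro x
    rw [abs_sub_comm, ← Real.dist_eq]
    apply ContDiffBump.dist_normed_convolution_le hφ.continuous.aestronglyMeasurable
    intro y hy
    apply (h1 _).le
    exact lt_of_lt_of_le (mem_ball.1 hy) ((min_le_right _ _).trans (min_le_left _ _))
  · intro x
    have hd := hcs.hasFDerivAt_convolution_right (μ := volume) (ContinuousLinearMap.lsmul ℝ ℝ)
      (f.continuous_normed (μ := volume)).locallyIntegrable hφ x
    rw [hd.fderiv, ← dist_eq_norm, dist_comm]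
    have key : (ContinuousLinearMap.precompR (EuclideanSpace ℝ (Fin N)) (ContinuousLinearMap.lsmul ℝ ℝ : ℝ →L[ℝ] ℝ →L[ℝ] ℝ)) = ContinuousLinearMap.lsmul ℝ ℝ := by
      ext a b
      simp
    rw [key]
    apply ContDiffBump.dist_normed_convolution_le hc1.aestronglyMeasurable
    intro y hy
    apply (h2 _).le
    exact lt_of_lt_of_le (mem_ball.1 hy) ((min_le_right _ _).trans (min_le_right _ _))

lemma llv_weak_ext {N : ℕ} (V : EuclideanSpace ℝ (Fin N) → EuclideanSpace ℝ (Fin N))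
    (w : EuclideanSpace ℝ (Fin N) → ℝ) (hV : Continuous V) (hw : Continuous w)
    (hweak : ∀ φ : EuclideanSpace ℝ (Fin N) → ℝ,
      ContDiff ℝ (⊤ : ℕ∞) φ → HasCompactSupport φ → (∀ x, 0 ≤ φ x) →
      (∫ x, fderiv ℝ φ x (V x)) + ∫ x, w x * φ x ≤ 0)
    (φ : EuclideanSpace ℝ (Fin N) → ℝ) (r : ℝ)
    (hφ : ContDiff ℝ 1 φ) (hφ0 : ∀ x, 0 ≤ φ x) (hr : ∀ x, r < ‖x‖ → φ x = 0) :
    ∫ x, (fderiv ℝ φ x (V x) + w x * φ x) ≤ 0 := by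
  have hintg : ∀ g : EuclideanSpace ℝ (Fin N) → ℝ, ContDiff ℝ 1 g → HasCompactSupport g →
      Integrable (fun x => fderiv ℝ g x (V x)) ∧ Integrable (fun x => w x * g x) := by
    intro g hg hgc
    have hc1 : Continuous (fderiv ℝ g) := hg.continuous_fderiv (by norm_num)
    constructor
    · apply Continuous.integrable_of_hasCompactSupport (hc1.clm_apply hV)
      apply (hgc.fderiv (𝕜 := ℝ)).mono
      intro x hx
      contrapose hx
      simp only [Function.mem_support, not_not] at hx ⊢
      simp [hx]
    · exact (hw.mul hg.continuous).integrable_of_hasCompactSupport hgc.mul_left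
  have hcs : HasCompactSupport φ := by
    refine HasCompactSupport.intro (isCompact_closedBall (0 : EuclideanSpace ℝ (Fin N)) r) ?_
    intro x hx
    exact hr x (by simpa using hx)
  set K := closedBall (0 : EuclideanSpace ℝ (Fin N)) (r + 1) with hK
  have hMi : IntegrableOn (fun x => ‖V x‖ + |w x|) K :=
    (hV.norm.add hw.abs).continuousOn.integrableOn_compact (isCompact_closedBall _ _)
  set M := ∫ x in K, (‖V x‖ + |w x|) with hM
  have hM0 : 0 ≤ M := integral_nonneg fun x => by positivity
  have key : ∀ ε : ℝ, 0 < ε → ∫ x, (fderiv ℝ φ x (V x) + w x * φ x) ≤ ε * M := by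
    intro ε hε
    obtain ⟨ψ, hψ, hψc, hψ0, hψr, hψ1, hψ2⟩ := llv_mollify φ r hφ hφ0 hr ε hε
    have hψ' : ContDiff ℝ 1 ψ := hψ.of_le (by exact_mod_cast le_top)
    obtain ⟨i1, i2⟩ := hintg φ hφ hcs
    obtain ⟨i3, i4⟩ := hintg ψ hψ' hψc
    have hz : ∀ x, x ∉ K → fderiv ℝ φ x = 0 ∧ fderiv ℝ ψ x = 0 ∧ φ x = 0 ∧ ψ x = 0 := by
      intro x hx
      have hx' : r + 1 < ‖x‖ := by simpa [hK] using hx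
      have hev : ∀ᶠ y in nhds x, r + 1 < ‖y‖ := continuous_norm.continuousAt.eventually (lt_mem_nhds hx')
      refine ⟨?_, ?_, hr x (by linarith), hψr x hx'⟩
      · have : φ =ᶠ[nhds x] fun _ => 0 := hev.mono fun y hy => hr y (by linarith)
        rw [this.fderiv_eq]; simp
      · have : ψ =ᶠ[nhds x] fun _ => 0 := hev.mono fun y hy => hψr y hy
        rw [this.fderiv_eq]; simp
    have hIi : Integrable (K.indicator (fun x => ε * (‖V x‖ + |w x|))) :=
      IntegrableOn.integrable_indicator (hMi.const_mul ε) measurableSet_closedBall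
    have hle : ∫ x, (fderiv ℝ φ x (V x) + w x * φ x) ≤
        ∫ x, ((fderiv ℝ ψ x (V x) + w x * ψ x) + K.indicator (fun x => ε * (‖V x‖ + |w x|)) x) := by
      apply integral_mono (i1.add i2)
      · exact (i3.add i4).add hIi
      · intro x
        by_cases hx : x ∈ K
        · simp only [Set.indicator_of_mem hx]
          have e1 : fderiv ℝ φ x (V x) - fderiv ℝ ψ x (V x) ≤ ε * ‖V x‖ := by
            rw [← sub_apply]
            refine (le_abs_self _).trans ?_
            exact ((fderiv ℝ φ x - fderiv ℝ ψ x).le_opNorm _).trans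
              (mul_le_mul_of_nonneg_right (hψ2 x) (norm_nonneg _))
          have e2 : w x * φ x - w x * ψ x ≤ ε * |w x| := by
            rw [← mul_sub]
            refine (le_abs_self _).trans ?_
            rw [abs_mul, mul_comm]
            exact mul_le_mul_of_nonneg_right (hψ1 x) (abs_nonneg _)
          simp only [Pi.add_apply]
          linarith
        · obtain ⟨z1, z2, z3, z4⟩ := hz x hx
          simp [Set.indicator_of_notMem hx, z1, z2, z3, z4]
    have hadd := integral_add (i3.add i4) hIi
    simp only [Pi.add_apply] at hadd
    rw [hadd] at hle
    rw [integral_indicator measurableSet_closedBall, integral_const_mul] at hle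
    have h5 := hweak ψ hψ hψc hψ0
    rw [← integral_add i3 i4] at h5
    linarith
  by_contra hpos
  push Not at hpos
  set I := ∫ x, (fderiv ℝ φ x (V x) + w x * φ x)
  have := key (I / (M + 1) / 2) (by positivity)
  have h2 : I / (M + 1) / 2 * M < I := by
    rw [div_div, div_mul_eq_mul_div, div_lt_iff₀ (by positivity)]
    nlinarith
  linarith

lemma llv_cutoff (N : ℕ) : ∃ C : ℝ, 0 < C ∧ ∀ R : ℝ, 0 < R →
    ∃ η : EuclideanSpace ℝ (Fin N) → ℝ, ContDiff ℝ 1 η ∧ (∀ x, 0 ≤ η x) ∧ (∀ x, η x ≤ 1) ∧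
      (∀ x, ‖x‖ ≤ R → η x = 1) ∧ (∀ x, 2 * R < ‖x‖ → η x = 0) ∧
      (∀ x, ‖fderiv ℝ η x‖ ≤ C / R) ∧
      ∀ x, fderiv ℝ η x ≠ 0 → R ≤ ‖x‖ ∧ ‖x‖ ≤ 2 * R := by
  let f : ContDiffBump (0 : EuclideanSpace ℝ (Fin N)) := ⟨1, 2, by norm_num, by norm_num⟩
  have hf : ContDiff ℝ 1 f := f.contDiff
  obtain ⟨C, hC⟩ := (f.hasCompactSupport.fderiv (𝕜 := ℝ)).exists_bound_of_continuous
    (hf.continuous_fderiv (by norm_num))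
  have hC0 : 0 ≤ C := (norm_nonneg _).trans (hC 0)
  refine ⟨C + 1, by linarith, fun R hR => ⟨fun x => f (R⁻¹ • x), ?_, ?_, ?_, ?_, ?_, ?_, ?_⟩⟩
  · exact hf.comp (contDiff_const_smul _)
  · intro x; exact f.nonneg
  · intro x; exact f.le_one
  · intro x hx
    apply f.one_of_mem_closedBall
    simp only [mem_closedBall, dist_zero_right, norm_smul, norm_inv, Real.norm_eq_abs, abs_of_pos hR, f]
    rw [inv_mul_le_iff₀ hR]; simpa using hx
  · intro x hx
    apply f.zero_of_le_dist
    simp only [dist_zero_right, norm_smul, norm_inv, Real.norm_eq_abs, abs_of_pos hR, f]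
    rw [le_inv_mul_iff₀ hR]; linarith
  · intro x
    rw [fderiv_comp_smul, norm_smul]
    simp only [norm_inv, Real.norm_eq_abs, abs_of_pos hR]
    rw [div_eq_inv_mul]
    gcongr
    linarith [hC (R⁻¹ • x)]
  · intro x hx
    constructor
    · by_contra hlt
      apply hx
      have hev : ∀ᶠ y in nhds x, ‖y‖ < R := continuous_norm.continuousAt.eventually (gt_mem_nhds (not_le.1 hlt))
      have : (fun x => f (R⁻¹ • x)) =ᶠ[nhds x] fun _ => 1 := by
        filter_upwards [hev] with y hy
        apply f.one_of_mem_closedBall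
        simp only [mem_closedBall, dist_zero_right, norm_smul, norm_inv, Real.norm_eq_abs, abs_of_pos hR, f]
        rw [inv_mul_le_iff₀ hR]; linarith
      rw [this.fderiv_eq]; simp
    · by_contra hlt
      apply hx
      have hev : ∀ᶠ y in nhds x, 2 * R < ‖y‖ := continuous_norm.continuousAt.eventually (lt_mem_nhds (not_le.1 hlt))
      have : (fun x => f (R⁻¹ • x)) =ᶠ[nhds x] fun _ => 0 := by
        filter_upwards [hev] with y hy
        apply f.zero_of_le_dist
        simp only [dist_zero_right, norm_smul, norm_inv, Real.norm_eq_abs, abs_of_pos hR, f]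
        rw [le_inv_mul_iff₀ hR]; linarith
      rw [this.fderiv_eq]; simp

lemma llv_cont_V {E : Type*} [NormedAddCommGroup E] [InnerProductSpace ℝ E] (p : ℝ) (hp : 1 < p) :
    Continuous (fun v : E => ‖v‖ ^ (p - 2) • v) := by
  rw [continuous_iff_continuousAt]
  intro v
  by_cases hv : v = 0
  · subst hv
    have hn : ∀ v : E, ‖‖v‖ ^ (p - 2) • v‖ = ‖v‖ ^ (p - 1) := by
      intro v
      rw [norm_smul, Real.norm_of_nonneg (by positivity)]
      by_cases h0 : v = 0
      · subst h0; simp [Real.zero_rpow (show p - 1 ≠ 0 by linarith)]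
      · have : 0 < ‖v‖ := norm_pos_iff.2 h0
        nth_rw 2 [← Real.rpow_one ‖v‖]
        rw [← Real.rpow_add this]; congr 1; ring
    have h2 : Filter.Tendsto (fun v : E => ‖v‖ ^ (p - 1)) (nhds 0) (nhds 0) := by
      have : Continuous (fun v : E => ‖v‖ ^ (p - 1)) :=
        continuous_norm.rpow_const (fun _ => Or.inr (by linarith))
      have h := this.tendsto 0
      simpa [Real.zero_rpow (show p - 1 ≠ 0 by linarith)] using h
    unfold ContinuousAt
    simp only [smul_zero]
    apply squeeze_zero_norm (fun v => (hn v).le) h2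
  · exact (continuousAt_id.norm.rpow_const (Or.inl (norm_ne_zero_iff.2 hv))).smul continuousAt_id

/-- The three-term Young inequality. -/
lemma llv_young (p q U g e H D θ κ : ℝ) (s m : ℕ) (hp : 1 < p) (hq : p - 1 < q) (hs : 1 ≤ s)
    (hm : 1 ≤ m) (hU : 0 ≤ U) (hg : 0 ≤ g) (he : 0 ≤ e) (he1 : e ≤ 1) (hH : 0 < H) (hD : 0 ≤ D)
    (hθ : θ = (s + p - 1) / (p * (q + s))) (hκ : κ = (q - p + 1) / (p * (q + s)))
    (hmκ : 1 ≤ m * κ) :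
    m * (U ^ s * e ^ (m - 1) * g ^ (p - 1) * D) ≤
      (p - 1) / p * (U ^ (s - 1) * g ^ p * e ^ m) + θ * (H * (U ^ q * U ^ s) * e ^ m) +
        κ * (m * D * H ^ (-θ)) ^ (1 / κ) := by
  have hs' : (1 : ℝ) ≤ s := by exact_mod_cast hs
  have hm' : (1 : ℝ) ≤ m := by exact_mod_cast hm
  have hqs : 0 < q + s := by linarith
  have hθ0 : 0 < θ := by rw [hθ]; apply div_pos <;> first | linarith | positivity
  have hκ0 : 0 < κ := by rw [hκ]; apply div_pos <;> first | linarith | positivity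
  have hα0 : 0 < (p - 1) / p := div_pos (by linarith) (by linarith)
  have hsum : (p - 1) / p + θ + κ = 1 := by
    rw [hθ, hκ]; field_simp; ring
  have hp0 : p ≠ 0 := by linarith
  have h3 := Real.geom_mean_le_arith_mean3_weighted hα0.le hθ0.le hκ0.le
    (show 0 ≤ U ^ (s - 1) * g ^ p * e ^ m by positivity)
    (show 0 ≤ H * (U ^ q * U ^ s) * e ^ m by positivity)
    (show 0 ≤ (m * D * H ^ (-θ)) ^ (1 / κ) by positivity) hsum
  refine le_trans ?_ h3
  have t3 : ((m * D * H ^ (-θ)) ^ (1 / κ)) ^ κ = m * D * H ^ (-θ) := by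
    rw [← Real.rpow_mul (by positivity), one_div, inv_mul_cancel₀ hκ0.ne', Real.rpow_one]
  have t1 : (U ^ (s - 1) * g ^ p * e ^ m) ^ ((p - 1) / p) =
      U ^ ((s - 1 : ℝ) * ((p - 1) / p)) * g ^ (p - 1) * e ^ (m * ((p - 1) / p)) := by
    rw [Real.mul_rpow (by positivity) (by positivity), Real.mul_rpow (by positivity) (by positivity)]
    rw [← Real.rpow_natCast U, ← Real.rpow_natCast e, ← Real.rpow_mul hU, ← Real.rpow_mul hg,
      ← Real.rpow_mul he, Nat.cast_sub hs]
    congr 3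
    · simp
    · field_simp
  have t2 : (H * (U ^ q * U ^ s) * e ^ m) ^ θ =
      H ^ θ * U ^ ((q + s) * θ) * e ^ (m * θ) := by
    rw [Real.mul_rpow (by positivity) (by positivity), Real.mul_rpow (by positivity) (by positivity)]
    rw [← Real.rpow_natCast U, ← Real.rpow_natCast e, ← Real.rpow_add_of_nonneg hU (by linarith) (by linarith),
      ← Real.rpow_mul hU, ← Real.rpow_mul he]
  rw [t1, t2, t3]
  have hHH : H ^ θ * H ^ (-θ) = 1 := by
    rw [← Real.rpow_add hH]; simp
  have hUU : U ^ ((s - 1 : ℝ) * ((p - 1) / p)) * U ^ ((q + s) * θ) = U ^ s := by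
    rw [← Real.rpow_add_of_nonneg hU (by apply mul_nonneg <;> linarith) (by positivity),
      ← Real.rpow_natCast U]
    congr 1
    rw [hθ]; field_simp; ring
  have hee : e ^ (m - 1) ≤ e ^ (m * ((p - 1) / p)) * e ^ (m * θ) := by
    rw [← Real.rpow_add_of_nonneg he (by positivity) (by positivity), ← Real.rpow_natCast e,
      Nat.cast_sub hm]
    rcases he.eq_or_lt with h0 | h0
    · subst h0
      rw [Real.zero_rpow (x := m * ((p - 1) / p) + m * θ) (by positivity)]
      by_cases hm1 : m = 1
      · exfalso
        subst hm1
        have : κ < 1 := by linarith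
        simp at hmκ
        linarith
      · have : (m : ℝ) - ((1 : ℕ) : ℝ) ≠ 0 := by
          rw [sub_ne_zero]; exact_mod_cast hm1
        rw [Real.zero_rpow this]
    · apply Real.rpow_le_rpow_of_exponent_ge h0 he1
      have : m * ((p - 1) / p) + m * θ = m - m * κ := by
        have : (p - 1) / p + θ = 1 - κ := by linarith
        rw [← mul_add, this]; ring
      rw [this]
      push_cast
      linarith
  calc m * (U ^ s * e ^ (m - 1) * g ^ (p - 1) * D)
      = m * D * U ^ s * g ^ (p - 1) * e ^ (m - 1) := by ring
    _ ≤ m * D * U ^ s * g ^ (p - 1) * (e ^ (m * ((p - 1) / p)) * e ^ (m * θ)) := by gcongr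
    _ = m * D * (U ^ ((s - 1 : ℝ) * ((p - 1) / p)) * U ^ ((q + s) * θ)) * g ^ (p - 1) *
          (e ^ (m * ((p - 1) / p)) * e ^ (m * θ)) * (H ^ θ * H ^ (-θ)) := by rw [hHH, hUU]; ring
    _ = _ := by ring

lemma llv_E (a γ θ κ R t D C m : ℝ) (ha : 0 < a) (hθ : 0 < θ) (hκ : 0 < κ) (hR : 0 < R)
    (hRt : R ≤ t) (htR : t ≤ 2 * R) (hD : 0 ≤ D) (hDC : D ≤ C / R) (hm : 0 ≤ m) :
    (m * D * (a * t ^ γ) ^ (-θ)) ^ (1 / κ) ≤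
      (m * C * a ^ (-θ) * 2 ^ (|γ| * θ)) ^ (1 / κ) * R ^ (-((1 + γ * θ) / κ)) := by
  have ht : 0 < t := by linarith
  have hC : 0 ≤ C := by
    have := hD.trans hDC
    rwa [le_div_iff₀ hR, zero_mul] at this
  have e1 : (a * t ^ γ) ^ (-θ) = a ^ (-θ) * t ^ (-(γ * θ)) := by
    rw [Real.mul_rpow ha.le (by positivity), ← Real.rpow_mul ht.le]
    congr 2; ring
  have e2 : t ^ (-(γ * θ)) ≤ 2 ^ (|γ| * θ) * R ^ (-(γ * θ)) := by
    have h1 : 1 ≤ t / R := by rw [le_div_iff₀ hR]; linarith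
    have h2 : t / R ≤ 2 := by rw [div_le_iff₀ hR]; linarith
    have : t ^ (-(γ * θ)) = (t / R) ^ (-(γ * θ)) * R ^ (-(γ * θ)) := by
      rw [← Real.mul_rpow (by positivity) hR.le]
      congr 1; field_simp
    rw [this]
    gcongr
    refine (Real.rpow_le_rpow_of_exponent_le h1 ?_).trans
      (Real.rpow_le_rpow (by positivity) h2 (by positivity))
    have := neg_abs_le γ
    nlinarith
  have e3 : R ^ (-((1 + γ * θ) / κ)) = (R ^ (-1 : ℝ) * R ^ (-(γ * θ))) ^ (1 / κ) := by
    rw [← Real.rpow_add hR, ← Real.rpow_mul hR.le]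
    congr 1; ring
  rw [e3, ← Real.mul_rpow (by positivity) (by positivity)]
  apply Real.rpow_le_rpow (by positivity) _ (by positivity)
  rw [e1, Real.rpow_neg_one]
  calc m * D * (a ^ (-θ) * t ^ (-(γ * θ)))
      ≤ m * (C / R) * (a ^ (-θ) * (2 ^ (|γ| * θ) * R ^ (-(γ * θ)))) := by gcongr
    _ = _ := by ring

lemma llv_est
    (N : ℕ) (p a γ q R₀ : ℝ) (hp : 1 < p) (hpN : p < N)
    (ha : 0 < a) (hγ : -p < γ) (hR₀ : 0 < R₀)
    (h : EuclideanSpace ℝ (Fin N) → ℝ)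
    (hh_cont : Continuous h) (hh_nonneg : ∀ x, 0 ≤ h x)
    (hh_eq : ∀ x : EuclideanSpace ℝ (Fin N), R₀ ≤ ‖x‖ → h x = a * ‖x‖ ^ γ)
    (hq : p - 1 < q)
    (u : EuclideanSpace ℝ (Fin N) → ℝ)
    (hu : ContDiff ℝ 1 u) (hu_nonneg : ∀ x, 0 ≤ u x)
    (hweak : ∀ φ : EuclideanSpace ℝ (Fin N) → ℝ,
      ContDiff ℝ (⊤ : ℕ∞) φ → HasCompactSupport φ → (∀ x, 0 ≤ φ x) →
      (∫ x, ‖gradient u x‖ ^ (p - 2) * ⟪gradient u x, gradient φ x⟫) +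
        ∫ x, h x * u x ^ q * φ x ≤ 0)
    (θ κ : ℝ) (s m : ℕ) (hs : 1 ≤ s) (hm : 1 ≤ m)
    (hθ : θ = (s + p - 1) / (p * (q + s))) (hκ : κ = (q - p + 1) / (p * (q + s)))
    (hmκ : 1 ≤ m * κ) :
    ∃ C : ℝ, ∀ R : ℝ, R₀ ≤ R →
      ∃ η : EuclideanSpace ℝ (Fin N) → ℝ, Continuous η ∧ (∀ x, 0 ≤ η x) ∧ (∀ x, η x ≤ 1) ∧
      (∀ x, ‖x‖ ≤ R → η x = 1) ∧ (∀ x, 2 * R < ‖x‖ → η x = 0) ∧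
      ∫ x, ((1 - (p - 1) / p) * (u x ^ (s - 1) * ‖gradient u x‖ ^ p)
        + (1 - θ) * (h x * (u x ^ q * u x ^ s))) * η x ^ m ≤
        C * R ^ (-((1 + γ * θ) / κ) + N) := by
  have hs' : (1 : ℝ) ≤ s := by exact_mod_cast hs
  have hqs : 0 < q + s := by linarith
  have hθ0 : 0 < θ := by rw [hθ]; apply div_pos <;> first | linarith | positivity
  have hκ0 : 0 < κ := by rw [hκ]; apply div_pos <;> first | linarith | positivity
  have hgc : Continuous (gradient u) := by
    have : Continuous (fderiv ℝ u) := hu.continuous_fderiv (by norm_num)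
    exact (InnerProductSpace.toDual ℝ _).symm.continuous.comp this
  have hVc : Continuous (fun x => ‖gradient u x‖ ^ (p - 2) • gradient u x) :=
    (llv_cont_V p hp).comp hgc
  have huq : Continuous (fun x => u x ^ q) :=
    hu.continuous.rpow_const (fun _ => Or.inr (by linarith))
  have hwc : Continuous (fun x => h x * u x ^ q) := hh_cont.mul huq
  have hext := llv_weak_ext _ _ hVc hwc (by
    intro φ h1 h2 h3
    have := hweak φ h1 h2 h3
    simpa [inner_gradient_right] using this)
  obtain ⟨C0, hC0, hcut⟩ := llv_cutoff N
  set C1 := κ * (m * C0 * a ^ (-θ) * 2 ^ (|γ| * θ)) ^ (1 / κ) with hC1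
  refine ⟨C1 * (2 ^ N * volume.real (ball (0 : EuclideanSpace ℝ (Fin N)) 1)), fun R hR => ?_⟩
  have hRp : 0 < R := by linarith
  obtain ⟨η, hη, hη0, hη1, hηR, hη2, hηd, hηs⟩ := hcut R hRp
  refine ⟨η, hη.continuous, hη0, hη1, hηR, hη2, ?_⟩
  have hm0 : m ≠ 0 := by omega
  have hφ : ContDiff ℝ 1 (fun x => u x ^ s * η x ^ m) := (hu.pow s).mul (hη.pow m)
  have hφr : ∀ x, 2 * R < ‖x‖ → u x ^ s * η x ^ m = 0 := by
    intro x hx; simp [hη2 x hx, hm0]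
  have hmain := hext (fun x => u x ^ s * η x ^ m) (2 * R) hφ
    (fun x => mul_nonneg (pow_nonneg (hu_nonneg x) _) (pow_nonneg (hη0 x) _)) hφr
  set G := fun x => (1 - (p - 1) / p) * (u x ^ (s - 1) * ‖gradient u x‖ ^ p)
        + (1 - θ) * (h x * (u x ^ q * u x ^ s)) with hG
  have hGc : Continuous G := by
    have h1 : Continuous (fun x => ‖gradient u x‖ ^ p) :=
      hgc.norm.rpow_const (fun _ => Or.inr (by linarith))
    have := hu.continuous
    fun_prop
  set K := closedBall (0 : EuclideanSpace ℝ (Fin N)) (2 * R) with hK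
  have hfd : ∀ x v, fderiv ℝ (fun x => u x ^ s * η x ^ m) x v =
      s * u x ^ (s - 1) * η x ^ m * fderiv ℝ u x v + m * u x ^ s * η x ^ (m - 1) * fderiv ℝ η x v := by
    intro x v
    have d1 := ((hu.differentiable (by norm_num)) x).hasFDerivAt.pow s
    have d2 := ((hη.differentiable (by norm_num)) x).hasFDerivAt.pow m
    have := (d1.mul d2).fderiv
    erw [this]
    simp
    ring
  set c := C1 * R ^ (-((1 + γ * θ) / κ)) with hc
  have hc0 : 0 ≤ c := by positivity
  have hpt : ∀ x, G x * η x ^ m ≤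
      (fderiv ℝ (fun x => u x ^ s * η x ^ m) x (‖gradient u x‖ ^ (p - 2) • gradient u x)
        + h x * u x ^ q * (u x ^ s * η x ^ m)) + K.indicator (fun _ => c) x := by
    intro x
    have hg0 : 0 ≤ ‖gradient u x‖ := norm_nonneg _
    have k1 : fderiv ℝ u x (‖gradient u x‖ ^ (p - 2) • gradient u x) = ‖gradient u x‖ ^ p := by
      rw [map_smul, ← inner_gradient_left, real_inner_self_eq_norm_sq, smul_eq_mul]
      rcases hg0.eq_or_lt with h0 | h0
      · rw [← h0, Real.zero_rpow (show p ≠ 0 by linarith)]; simp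
      · rw [← Real.rpow_natCast, ← Real.rpow_add h0]; congr 1; push_cast; ring
    have k2 : -(‖gradient u x‖ ^ (p - 1) * ‖fderiv ℝ η x‖) ≤
        fderiv ℝ η x (‖gradient u x‖ ^ (p - 2) • gradient u x) := by
      refine (neg_le_neg ?_).trans (neg_abs_le _)
      refine ((fderiv ℝ η x).le_opNorm _).trans ?_
      rw [mul_comm]
      gcongr
      rw [norm_smul, Real.norm_of_nonneg (by positivity)]
      rcases hg0.eq_or_lt with h0 | h0
      · rw [← h0, Real.zero_rpow (show p - 1 ≠ 0 by linarith)]; simp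
      · nth_rw 2 [← Real.rpow_one ‖gradient u x‖]
        rw [← Real.rpow_add h0]; apply le_of_eq; congr 1; ring
    have k3 : m * (u x ^ s * η x ^ (m - 1) * ‖gradient u x‖ ^ (p - 1) * ‖fderiv ℝ η x‖) ≤
      (p - 1) / p * (u x ^ (s - 1) * ‖gradient u x‖ ^ p * η x ^ m)
        + θ * (h x * (u x ^ q * u x ^ s) * η x ^ m) + K.indicator (fun _ => c) x := by
      have hux := hu_nonneg x
      have hηx := hη0 x
      have hhx := hh_nonneg x
      have hi : 0 ≤ K.indicator (fun _ => c) x := Set.indicator_nonneg (fun _ _ => hc0) x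
      by_cases hD : fderiv ℝ η x = 0
      · have : 0 ≤ (p - 1) / p := div_nonneg (by linarith) (by linarith)
        rw [hD]
        simp only [norm_zero, mul_zero]
        positivity
      · obtain ⟨r1, r2⟩ := hηs x hD
        have hxK : x ∈ K := by simpa [hK] using r2
        have hxh := hh_eq x (hR.trans r1)
        have hxp : 0 < ‖x‖ := by linarith
        have hH : 0 < h x := by rw [hxh]; positivity
        have y := llv_young p q (u x) ‖gradient u x‖ (η x) (h x) ‖fderiv ℝ η x‖ θ κ s m hp hq hs hm
          hux hg0 hηx (hη1 x) hH (norm_nonneg _) hθ hκ hmκ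
        refine y.trans ?_
        rw [Set.indicator_of_mem hxK, hc, hC1, mul_assoc κ]
        have z := llv_E a γ θ κ R ‖x‖ ‖fderiv ℝ η x‖ C0 m ha hθ0 hκ0 hRp r1 r2 (norm_nonneg _) (hηd x)
          (by positivity)
        rw [← hxh] at z
        gcongr
    rw [hfd, k1]
    have k4 : 0 ≤ u x ^ (s - 1) * ‖gradient u x‖ ^ p * η x ^ m :=
      mul_nonneg (mul_nonneg (pow_nonneg (hu_nonneg x) _) (by positivity)) (pow_nonneg (hη0 x) _)
    have k5 : 0 ≤ (m : ℝ) * u x ^ s * η x ^ (m - 1) :=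
      mul_nonneg (mul_nonneg (by positivity) (pow_nonneg (hu_nonneg x) _)) (pow_nonneg (hη0 x) _)
    have k6 := mul_le_mul_of_nonneg_left k2 k5
    have k7 : 0 ≤ ((s : ℝ) - 1) * (u x ^ (s - 1) * ‖gradient u x‖ ^ p * η x ^ m) :=
      mul_nonneg (by linarith) k4
    simp only [hG]
    linarith
  have hηc : HasCompactSupport (fun x => η x ^ m) := by
    refine HasCompactSupport.intro (isCompact_closedBall (0 : EuclideanSpace ℝ (Fin N)) (2 * R)) ?_
    intro x hx
    simp [hη2 x (by simpa using hx), hm0]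
  have hφc : HasCompactSupport (fun x => u x ^ s * η x ^ m) := hηc.mul_left
  have i1 : Integrable (fun x => G x * η x ^ m) :=
    (hGc.mul (hη.continuous.pow m)).integrable_of_hasCompactSupport hηc.mul_left
  have i2 : Integrable (fun x =>
      fderiv ℝ (fun x => u x ^ s * η x ^ m) x (‖gradient u x‖ ^ (p - 2) • gradient u x)) := by
    apply Continuous.integrable_of_hasCompactSupport
      ((hφ.continuous_fderiv (by norm_num)).clm_apply hVc)
    apply (hφc.fderiv (𝕜 := ℝ)).mono
    intro x hx
    contrapose hx
    simp only [Function.mem_support, not_not] at hx ⊢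
    rw [hx]; simp
  have i3 : Integrable (fun x => h x * u x ^ q * (u x ^ s * η x ^ m)) :=
    (hwc.mul hφ.continuous).integrable_of_hasCompactSupport hφc.mul_left
  have i4 : Integrable (K.indicator (fun _ => c)) :=
    IntegrableOn.integrable_indicator (integrableOn_const (isCompact_closedBall _ _).measure_lt_top.ne)
      measurableSet_closedBall
  have hle := integral_mono i1 ((i2.add i3).add i4) hpt
  have hadd := integral_add (i2.add i3) i4
  simp only [Pi.add_apply] at hle hadd
  rw [hadd, integral_indicator measurableSet_closedBall, setIntegral_const,
    Measure.addHaar_real_closedBall _ _ (by positivity), finrank_euclideanSpace_fin] at hle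
  refine (hle.trans (add_le_of_nonpos_left hmain)).trans (le_of_eq ?_)
  rw [Real.rpow_add hRp, Real.rpow_natCast, hc, smul_eq_mul, mul_pow]
  ring

/-- Liouville theorem for the negative semilinear case: for `N > p > 1`,
`h(x) = a|x|^γ` at infinity with `a > 0`, `γ > -p`, and `q > p - 1`, any nonnegative
weak solution of `-Δ_p u + h u^q ≤ 0` in `ℝ^N` vanishes identically. -/
theorem liouville_negative_semilinear
    (N : ℕ) (p a γ q R₀ : ℝ) (hp : 1 < p) (hpN : p < N)
    (ha : 0 < a) (hγ : -p < γ) (hR₀ : 0 < R₀)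
    (h : EuclideanSpace ℝ (Fin N) → ℝ)
    (hh_cont : Continuous h) (hh_nonneg : ∀ x, 0 ≤ h x)
    (hh_eq : ∀ x : EuclideanSpace ℝ (Fin N), R₀ ≤ ‖x‖ → h x = a * ‖x‖ ^ γ)
    (hq : p - 1 < q)
    (u : EuclideanSpace ℝ (Fin N) → ℝ)
    (hu : ContDiff ℝ 1 u) (hu_nonneg : ∀ x, 0 ≤ u x)
    (hweak : ∀ φ : EuclideanSpace ℝ (Fin N) → ℝ,
      ContDiff ℝ (⊤ : ℕ∞) φ → HasCompactSupport φ → (∀ x, 0 ≤ φ x) →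
      (∫ x, ‖gradient u x‖ ^ (p - 2) * ⟪gradient u x, gradient φ x⟫) +
        ∫ x, h x * u x ^ q * φ x ≤ 0) :
    ∀ x, u x = 0 := by
  -- choice of the exponents
  obtain ⟨s, hs⟩ := exists_nat_gt (max 1 ((N - p) * (q - p + 1) / (γ + p)))
  have hs1' : (1 : ℝ) < s := (le_max_left _ _).trans_lt hs
  have hs1 : 1 < s := by exact_mod_cast hs1'
  have hs2 : (N - p) * (q - p + 1) < s * (γ + p) := by
    have := (le_max_right _ _).trans_lt hs
    rwa [div_lt_iff₀ (by linarith)] at this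
  have hqs : 0 < q + s := by linarith
  obtain ⟨θ, hθ⟩ : ∃ θ, θ = (s + p - 1) / (p * (q + s)) := ⟨_, rfl⟩
  obtain ⟨κ, hκ⟩ : ∃ κ, κ = (q - p + 1) / (p * (q + s)) := ⟨_, rfl⟩
  have hκ0 : 0 < κ := by rw [hκ]; apply div_pos <;> first | linarith | positivity
  have hθ1 : θ < 1 := by
    rw [hθ, div_lt_one (by positivity)]
    nlinarith
  obtain ⟨m, hm⟩ := exists_nat_gt (1 / κ)
  have hmκ : 1 ≤ m * κ := by
    rw [div_lt_iff₀ hκ0] at hm; exact hm.le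
  have hm1 : 1 ≤ m := by
    rcases Nat.eq_zero_or_pos m with h0 | h0
    · subst h0; simp at hmκ; linarith
    · exact h0
  obtain ⟨C, hC⟩ := llv_est N p a γ q R₀ hp hpN ha hγ hR₀ h hh_cont hh_nonneg hh_eq hq u hu hu_nonneg
    hweak θ κ s m hs1.le hm1 hθ hκ hmκ
  have hexp : -((1 + γ * θ) / κ) + N < 0 := by
    have e : (1 + γ * θ) / κ = p + (γ + p) * (s + p - 1) / (q - p + 1) := by
      have h1 : q - p + 1 ≠ 0 := by linarith
      rw [hθ, hκ]; field_simp; ring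
    have : N - p < (γ + p) * (s + p - 1) / (q - p + 1) := by
      rw [lt_div_iff₀ (by linarith)]
      nlinarith
    rw [e]; linarith
  have hα : 0 < 1 - (p - 1) / p := by
    rw [sub_pos, div_lt_one (by linarith)]; linarith
  have hgc : Continuous (gradient u) := by
    have : Continuous (fderiv ℝ u) := hu.continuous_fderiv (by norm_num)
    exact (InnerProductSpace.toDual ℝ _).symm.continuous.comp this
  have huq : Continuous (fun x => u x ^ q) :=
    hu.continuous.rpow_const (fun _ => Or.inr (by linarith))
  set G := fun x => (1 - (p - 1) / p) * (u x ^ (s - 1) * ‖gradient u x‖ ^ p)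
        + (1 - θ) * (h x * (u x ^ q * u x ^ s)) with hG
  have hGc : Continuous G := by
    have h1 : Continuous (fun x => ‖gradient u x‖ ^ p) :=
      hgc.norm.rpow_const (fun _ => Or.inr (by linarith))
    have := hu.continuous
    fun_prop
  have hp1 : ∀ x, 0 ≤ u x ^ (s - 1) * ‖gradient u x‖ ^ p := fun x =>
    mul_nonneg (pow_nonneg (hu_nonneg x) _) (by positivity)
  have hp2 : ∀ x, 0 ≤ h x * (u x ^ q * u x ^ s) := fun x =>
    mul_nonneg (hh_nonneg x) (mul_nonneg (Real.rpow_nonneg (hu_nonneg x) _) (pow_nonneg (hu_nonneg x) _))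
  have hGn : ∀ x, 0 ≤ G x := fun x =>
    add_nonneg (mul_nonneg hα.le (hp1 x)) (mul_nonneg (by linarith) (hp2 x))
  have hcomp : ∀ (η : EuclideanSpace ℝ (Fin N) → ℝ) (R : ℝ), (∀ x, 2 * R < ‖x‖ → η x = 0) →
      HasCompactSupport (fun x => G x * η x ^ m) := by
    intro η R hη
    refine HasCompactSupport.intro (isCompact_closedBall (0 : EuclideanSpace ℝ (Fin N)) (2 * R)) ?_
    intro x hx
    have hm0 : m ≠ 0 := by omega
    simp [hη x (by simpa using hx), hm0]
  have hG0 : ∀ x, G x = 0 := by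
    intro x0
    by_contra hne
    obtain ⟨η₁, c1, n1, l1, o1, z1, -⟩ := hC (max R₀ ‖x0‖) (le_max_left _ _)
    have hpos : 0 < ∫ x, G x * η₁ x ^ m := by
      refine (hGc.mul (c1.pow m)).integral_pos_of_hasCompactSupport_nonneg_nonzero (x := x0)
        (hcomp η₁ _ z1) (fun x => mul_nonneg (hGn x) (pow_nonneg (n1 x) _)) ?_
      rw [o1 x0 (le_max_right _ _)]; simpa using hne
    have hbd : ∀ R, 2 * max R₀ ‖x0‖ ≤ R →
        ∫ x, G x * η₁ x ^ m ≤ C * R ^ (-((1 + γ * θ) / κ) + N) := by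
      intro R hR
      have : R₀ ≤ max R₀ ‖x0‖ := le_max_left _ _
      obtain ⟨η, c2, n2, l2, o2, z2, b2⟩ := hC R (by linarith)
      refine le_trans ?_ b2
      apply integral_mono
      · exact (hGc.mul (c1.pow m)).integrable_of_hasCompactSupport (hcomp η₁ _ z1)
      · exact (hGc.mul (c2.pow m)).integrable_of_hasCompactSupport (hcomp η _ z2)
      · intro x
        apply mul_le_mul_of_nonneg_left _ (hGn x)
        apply pow_le_pow_left₀ (n1 x)
        by_cases hx : 2 * max R₀ ‖x0‖ < ‖x‖
        · rw [z1 x hx]; exact n2 x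
        · rw [o2 x (by linarith)]; exact l1 x
    have hlim : Filter.Tendsto (fun R : ℝ => C * R ^ (-((1 + γ * θ) / κ) + N)) Filter.atTop (nhds 0) := by
      have := (tendsto_rpow_neg_atTop (y := -(-((1 + γ * θ) / κ) + N)) (by linarith)).const_mul C
      simpa only [neg_neg, mul_zero] using this
    have := ge_of_tendsto hlim ((Filter.eventually_ge_atTop _).mono hbd)
    linarith
  have hsep : ∀ x, u x ^ (s - 1) * ‖gradient u x‖ ^ p = 0 ∧ h x * (u x ^ q * u x ^ s) = 0 := by
    intro x
    have h0 := hG0 x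
    simp only [hG] at h0
    have a1 := mul_nonneg hα.le (hp1 x)
    have a2 := mul_nonneg (sub_nonneg.2 hθ1.le) (hp2 x)
    constructor
    · have : (1 - (p - 1) / p) * (u x ^ (s - 1) * ‖gradient u x‖ ^ p) = 0 := by linarith
      exact (mul_eq_zero.1 this).resolve_left hα.ne'
    · have : (1 - θ) * (h x * (u x ^ q * u x ^ s)) = 0 := by linarith
      exact (mul_eq_zero.1 this).resolve_left (by linarith)
  have hconst : ∀ x y, u x ^ s = u y ^ s := by
    apply is_const_of_fderiv_eq_zero (𝕜 := ℝ) (f := fun x => u x ^ s)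
    · exact (hu.pow s).differentiable (by norm_num)
    · intro x
      have d1 := (((hu.differentiable (by norm_num)) x).hasFDerivAt.pow s).fderiv
      erw [d1]
      rcases mul_eq_zero.1 (hsep x).1 with h0 | h0
      · simp [h0]
      · have : gradient u x = 0 := by
          rw [Real.rpow_eq_zero (norm_nonneg _) (by linarith)] at h0
          exact norm_eq_zero.1 h0
        have : fderiv ℝ u x = 0 := by rw [← toDual_gradient, this, map_zero]
        simp [this]
  have hN : 0 < N := by
    have : (0 : ℝ) < N := by linarith
    exact_mod_cast this
  have : Nonempty (Fin N) := ⟨⟨0, hN⟩⟩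
  obtain ⟨y, hy⟩ := exists_norm_eq (EuclideanSpace ℝ (Fin N)) hR₀.le
  have huy : u y = 0 := by
    have h1 := (hsep y).2
    have h2 : h y ≠ 0 := by rw [hh_eq y hy.ge, hy]; positivity
    rcases (hu_nonneg y).eq_or_lt with h3 | h3
    · exact h3.symm
    · exfalso
      have : 0 < u y ^ q * u y ^ s := by positivity
      exact (mul_ne_zero h2 this.ne') h1
  intro x
  have h4 := hconst x y
  rw [huy, zero_pow (by omega)] at h4
  exact eq_zero_of_pow_eq_zero h4
end
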